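/- Let (X,d,φ) be a mixing semi-conformal Smale space (i.e. λ_X = min{Lip(φ), Lip(φ^{-1})}) admitting a refining sequence (ℛ_n)_{n≥0} of Markov partitions (with diam(R) ≤ ε''_X/2 for every R ∈ ℛ₁) that satisfies the uniform finite clustering property. Then there exists a φ-invariant Borel probability measure on X that is Ahlfors s₀-regular, where s₀ = 2·h(φ)/log(λ_X). Consequently, the Hausdorff dimension of (X,d) equals s₀, and the s₀-dimensional Hausdorff measure of X is strictly positive. -/

import Mathlib

open Set Metric MeasureTheory Topology
open scoped ENNReal NNReal

/-- A dynamical system is irreducible if for every ordered pair of nonempty open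
sets `U, V` there is `n : ℕ` with `ψ^[n] '' U ∩ V ≠ ∅`. -/
def IrreducibleSystem {Z : Type*} [TopologicalSpace Z] (ψ : Z → Z) : Prop :=
  ∀ U V : Set Z, IsOpen U → IsOpen V → U.Nonempty → V.Nonempty →
    ∃ n : ℕ, (ψ^[n] '' U ∩ V).Nonempty

/-- A dynamical system is mixing if for every ordered pair of nonempty open sets
`U, V` there is `N : ℕ` with `ψ^[n] '' U ∩ V ≠ ∅` for all `n ≥ N`. -/
def MixingSystem {Z : Type*} [TopologicalSpace Z] (ψ : Z → Z) : Prop :=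
  ∀ U V : Set Z, IsOpen U → IsOpen V → U.Nonempty → V.Nonempty →
    ∃ N : ℕ, ∀ n ≥ N, (ψ^[n] '' U ∩ V).Nonempty

/-- The (possibly infinite) Lipschitz constant of a map between metric spaces. -/
noncomputable def lipConst {X : Type*} [PseudoEMetricSpace X] (f : X → X) : ℝ≥0∞ :=
  sInf {K : ℝ≥0∞ | ∀ x y : X, edist (f x) (f y) ≤ K * edist x y}

/-- A measure on a metric space is Ahlfors `s`-regular if closed balls of radius
`r < diam Z` have measure comparable to `r ^ s`. -/
def AhlforsRegular {Z : Type*} [MetricSpace Z] [MeasurableSpace Z]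
    (μ : Measure Z) (s : ℝ) : Prop :=
  0 < s ∧ ∃ C : ℝ, 0 < C ∧ ∀ (z : Z) (r : ℝ), 0 ≤ r → r < diam (Set.univ : Set Z) →
    ENNReal.ofReal (C⁻¹ * r ^ s) ≤ μ (closedBall z r) ∧
    μ (closedBall z r) ≤ ENNReal.ofReal (C * r ^ s)

/-- A Smale space: a compact metric space together with a homeomorphism `phi`,
constants `eps > 0`, `lam > 1` and a partially defined continuous bracket map
satisfying the bracket axioms and the contraction axioms. -/
structure SmaleSpace (X : Type*) [MetricSpace X] where
  phi : Equiv.Perm X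
  phi_cont : Continuous phi
  phi_symm_cont : Continuous phi.symm
  eps : ℝ
  lam : ℝ
  eps_pos : 0 < eps
  one_lt_lam : 1 < lam
  bracket : X → X → X
  bracket_cont : ContinuousOn (fun p : X × X => bracket p.1 p.2)
    {p : X × X | dist p.1 p.2 ≤ eps}
  bracket_self : ∀ x : X, bracket x x = x
  bracket_assoc₁ : ∀ x y z : X, dist y z ≤ eps → dist x (bracket y z) ≤ eps →
    dist x z ≤ eps → bracket x (bracket y z) = bracket x z
  bracket_assoc₂ : ∀ x y z : X, dist x y ≤ eps → dist (bracket x y) z ≤ eps →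
    dist x z ≤ eps → bracket (bracket x y) z = bracket x z
  bracket_phi : ∀ x y : X, dist x y ≤ eps → dist (phi x) (phi y) ≤ eps →
    phi (bracket x y) = bracket (phi x) (phi y)
  contract_s : ∀ (x : X) (ε : ℝ), 0 < ε → ε ≤ eps → ∀ y z : X,
    dist x y < ε → bracket x y = y → dist x z < ε → bracket x z = z →
    dist (phi y) (phi z) ≤ lam⁻¹ * dist y z
  contract_u : ∀ (x : X) (ε : ℝ), 0 < ε → ε ≤ eps → ∀ y z : X,
    dist x y < ε → bracket y x = y → dist x z < ε → bracket z x = z →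
    dist (phi.symm y) (phi.symm z) ≤ lam⁻¹ * dist y z

namespace SmaleSpace

variable {X : Type*} [MetricSpace X] (S : SmaleSpace X)

/-- The local stable set `X^s(x, ε)`. -/
def stable (x : X) (ε : ℝ) : Set X := {y | dist x y < ε ∧ S.bracket x y = y}

/-- The local unstable set `X^u(x, ε)`. -/
def unstable (x : X) (ε : ℝ) : Set X := {y | dist x y < ε ∧ S.bracket y x = y}

/-- A rectangle (relative to the constant `ε'`): a nonempty set of diameter at
most `ε'` closed under the bracket. -/
def IsRectangle (ε' : ℝ) (R : Set X) : Prop :=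
  R.Nonempty ∧ diam R ≤ ε' ∧ ∀ x ∈ R, ∀ y ∈ R, S.bracket x y ∈ R

/-- A proper rectangle: a closed rectangle equal to the closure of its interior. -/
def IsProperRectangle (ε' : ℝ) (R : Set X) : Prop :=
  S.IsRectangle ε' R ∧ IsClosed R ∧ R = closure (interior R)

/-- `X^s(x, R) = X^s(x, 2ε') ∩ R`. -/
def stableIn (ε' : ℝ) (x : X) (R : Set X) : Set X := S.stable x (2 * ε') ∩ R

/-- `X^u(x, R) = X^u(x, 2ε') ∩ R`. -/
def unstableIn (ε' : ℝ) (x : X) (R : Set X) : Set X := S.unstable x (2 * ε') ∩ R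

/-- A Markov partition: a finite cover by nonempty proper rectangles with
pairwise disjoint interiors, satisfying the Markov conditions. -/
def IsMarkovPartition (ε' : ℝ) (P : Set (Set X)) : Prop :=
  P.Finite ∧ ⋃₀ P = Set.univ ∧
  (∀ R ∈ P, S.IsProperRectangle ε' R) ∧
  (∀ R ∈ P, ∀ R' ∈ P, R ≠ R' → interior R ∩ interior R' = ∅) ∧
  (∀ R ∈ P, ∀ R' ∈ P, ∀ x : X, x ∈ interior R → S.phi x ∈ interior R' →
    S.unstableIn ε' (S.phi x) R' ⊆ S.phi '' (S.unstableIn ε' x R) ∧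
    S.phi '' (S.stableIn ε' x R) ⊆ S.stableIn ε' (S.phi x) R')

/-- The refining sequence of Markov partitions
`ℛ_n = {⋂_{i=1-n}^{n-1} φ^{-i}(R_{x_i}) : R_{x_i} ∈ ℛ₁, int ≠ ∅}`, with
`ℛ₀ = {X}`. -/
def markovSeq (P : Set (Set X)) : ℕ → Set (Set X)
  | 0 => {Set.univ}
  | (n + 1) => {R | (interior R).Nonempty ∧ ∃ g : ℤ → Set X, (∀ i : ℤ, g i ∈ P) ∧
      R = ⋂ i ∈ Finset.Icc (-(n : ℤ)) (n : ℤ), (⇑(S.phi ^ i)) ⁻¹' (g i)}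

end SmaleSpace

/-- `N_𝒰(Y)`: the elements of the cover `𝒰` meeting the set `Y`. -/
def nbr {X : Type*} (U : Set (Set X)) (Y : Set X) : Set (Set X) :=
  {u ∈ U | (u ∩ Y).Nonempty}

/-- The property defining the constant `ε'_X` of a Smale space. -/
def SmaleSpace.epsOne {X : Type*} [MetricSpace X] (S : SmaleSpace X) (ε' : ℝ) : Prop :=
  0 < ε' ∧ ε' ≤ S.eps / 2 ∧ ∀ x y : X, dist x y ≤ ε' →
    dist x (S.bracket x y) < S.eps / 2 ∧ dist y (S.bracket x y) < S.eps / 2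

/-- The property defining the constant `ε''_X` of a Smale space. -/
def SmaleSpace.epsTwo {X : Type*} [MetricSpace X] (S : SmaleSpace X) (ε' ε'' : ℝ) : Prop :=
  0 < ε'' ∧ ε'' < ε' / 12 ∧ ∀ x y : X, dist x y ≤ ε'' →
    (∀ i : ℤ, |i| ≤ 2 → dist ((S.phi ^ i) x) ((S.phi ^ i) y) ≤ ε' / 2) ∧
    dist (S.bracket x y) x ≤ ε' / 4 ∧ dist (S.bracket x y) y ≤ ε' / 4

open Set Metric Topology MeasureTheory
open scoped ENNReal

open Set Metric MeasureTheory Topology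
open scoped ENNReal NNReal

namespace SmaleSpace

variable {X : Type*} [MetricSpace X] (S : SmaleSpace X)

/-- Convenient package of the facts used about a Markov partition. -/
structure MS (P : Set (Set X)) (e : ℝ) : Prop where
  fin : P.Finite
  cov : ∀ x, ∃ R ∈ P, x ∈ R
  closed : ∀ R ∈ P, IsClosed R
  cl : ∀ R ∈ P, R = closure (interior R)
  ne : ∀ R ∈ P, R.Nonempty
  disj : ∀ R ∈ P, ∀ R' ∈ P, ∀ x, x ∈ interior R → x ∈ interior R' → R = R'
  epos : 0 < e
  elt : e < S.eps
  small : ∀ R ∈ P, ∀ x ∈ R, ∀ y ∈ R, dist x y ≤ e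
  br : ∀ R ∈ P, ∀ x ∈ R, ∀ y ∈ R, S.bracket x y ∈ R
  fwd : ∀ R ∈ P, ∀ R' ∈ P, ∀ x ∈ interior R, S.phi x ∈ interior R' → ∀ z ∈ R,
    S.bracket x z = z → S.phi z ∈ R' ∧ S.bracket (S.phi x) (S.phi z) = S.phi z
  bwd : ∀ R ∈ P, ∀ R' ∈ P, ∀ x ∈ interior R, S.phi x ∈ interior R' → ∀ z ∈ R',
    S.bracket z (S.phi x) = z →
      S.phi.symm z ∈ R ∧ S.bracket (S.phi.symm z) x = S.phi.symm z

theorem MS.of [CompactSpace X] {ε' ε'' : ℝ}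
    (hε' : S.epsOne ε') (hε'' : S.epsTwo ε' ε'')
    {R1 : Set (Set X)} (hMP : S.IsMarkovPartition ε' R1)
    (hdiam : ∀ R ∈ R1, diam R ≤ ε'' / 2) : S.MS R1 (ε'' / 2) := by
  obtain ⟨h1, h2, h3, h4, h5⟩ := hMP
  obtain ⟨e1, e2, -⟩ := hε'
  obtain ⟨f1, f2, -⟩ := hε''
  have hsmall : ∀ R ∈ R1, ∀ x ∈ R, ∀ y ∈ R, dist x y ≤ ε'' / 2 := fun R hR x hx y hy =>
    (dist_le_diam_of_mem (isBounded_of_compactSpace) hx hy).trans (hdiam R hR)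
  refine ⟨h1, ?_, fun R hR => (h3 R hR).2.1, fun R hR => (h3 R hR).2.2,
    fun R hR => (h3 R hR).1.1, ?_, by linarith, by linarith, hsmall,
    fun R hR => (h3 R hR).1.2.2, ?_, ?_⟩
  · intro x
    have : x ∈ ⋃₀ R1 := h2 ▸ mem_univ x
    simpa using this
  · intro R hR R' hR' x hx hx'
    by_contra hne
    have := h4 R hR R' hR' hne
    exact (this ▸ (⟨hx, hx'⟩ : x ∈ interior R ∩ interior R') : x ∈ (∅ : Set X))
  · intro R hR R' hR' x hx hx' z hz hb
    have := (h5 R hR R' hR' x hx hx').2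
    have hz' : z ∈ S.stableIn ε' x R :=
      ⟨⟨(hsmall R hR x (interior_subset hx) z hz).trans_lt (by linarith), hb⟩, hz⟩
    have := this (mem_image_of_mem _ hz')
    exact ⟨this.2, this.1.2⟩
  · intro R hR R' hR' x hx hx' z hz hb
    have := (h5 R hR R' hR' x hx hx').1
    have hz' : z ∈ S.unstableIn ε' (S.phi x) R' :=
      ⟨⟨(hsmall R' hR' _ (interior_subset hx') z hz).trans_lt (by linarith), hb⟩, hz⟩
    obtain ⟨w, hw, rfl⟩ := this hz'
    simp only [Equiv.symm_apply_apply]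
    exact ⟨hw.2, hw.1.2⟩

/-- Inverse Smale space. -/
def inv : SmaleSpace X where
  phi := S.phi⁻¹
  phi_cont := S.phi_symm_cont
  phi_symm_cont := S.phi_cont
  eps := S.eps
  lam := S.lam
  eps_pos := S.eps_pos
  one_lt_lam := S.one_lt_lam
  bracket x y := S.bracket y x
  bracket_cont := by
    have := S.bracket_cont
    refine this.comp (f := fun p : X × X => (p.2, p.1)) (by fun_prop) ?_
    intro p hp
    simpa [dist_comm] using hp
  bracket_self := S.bracket_self
  bracket_assoc₁ x y z h1 h2 h3 := by
    rw [dist_comm] at h1 h2 h3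
    exact S.bracket_assoc₂ z y x h1 h2 h3
  bracket_assoc₂ x y z h1 h2 h3 := by
    rw [dist_comm] at h1 h2 h3
    exact S.bracket_assoc₁ z y x h1 h2 h3
  bracket_phi x y h1 h2 := by
    have h1' : dist (S.phi (S.phi.symm y)) (S.phi (S.phi.symm x)) ≤ S.eps := by
      simpa [dist_comm] using h1
    have h2' : dist (S.phi.symm y) (S.phi.symm x) ≤ S.eps := by
      rw [dist_comm]; exact h2
    have := S.bracket_phi (S.phi.symm y) (S.phi.symm x) h2' h1'
    simp only [Equiv.apply_symm_apply] at this
    change S.phi.symm (S.bracket y x) = S.bracket (S.phi.symm y) (S.phi.symm x)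
    rw [← this, Equiv.symm_apply_apply]
  contract_s := S.contract_u
  contract_u := S.contract_s

theorem MS.inv {S : SmaleSpace X} {P : Set (Set X)} {e : ℝ} (M : S.MS P e) : S.inv.MS P e where
  fin := M.fin
  cov := M.cov
  closed := M.closed
  cl := M.cl
  ne := M.ne
  disj := M.disj
  epos := M.epos
  elt := M.elt
  small := M.small
  br R hR x hx y hy := M.br R hR y hy x hx
  fwd R hR R' hR' x hx hx' z hz hb := by
    have := M.bwd R' hR' R hR (S.phi.symm x) hx' (by simpa using hx) z hz (by rw [Equiv.apply_symm_apply]; exact hb)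
    exact this
  bwd R hR R' hR' x hx hx' z hz hb := by
    have := M.fwd R' hR' R hR (S.phi.symm x) hx' (by simpa using hx) z hz hb
    simp only [Equiv.apply_symm_apply] at this
    exact this

theorem inv_markovSeq (P : Set (Set X)) (n : ℕ) : S.inv.markovSeq P n = S.markovSeq P n := by
  cases n with
  | zero => rfl
  | succ n =>
    ext R
    simp only [markovSeq, mem_ofPred_eq]
    refine and_congr_right fun _ => ⟨?_, ?_⟩
    · rintro ⟨g, hg, rfl⟩
      refine ⟨fun i => g (-i), fun i => hg _, ?_⟩
      ext x
      simp only [mem_iInter, mem_preimage, Finset.mem_Icc]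
      constructor
      · intro H i hi
        have := H (-i) (by omega)
        simpa [SmaleSpace.inv] using this
      · intro H i hi
        have := H (-i) (by omega)
        simpa [SmaleSpace.inv] using this
    · rintro ⟨g, hg, rfl⟩
      refine ⟨fun i => g (-i), fun i => hg _, ?_⟩
      ext x
      simp only [mem_iInter, mem_preimage, Finset.mem_Icc]
      constructor
      · intro H i hi
        have := H (-i) (by omega)
        simpa [SmaleSpace.inv] using this
      · intro H i hi
        have := H (-i) (by omega)
        simpa [SmaleSpace.inv] using this

theorem zpow_add_apply (i j : ℤ) (x : X) : (S.phi ^ (i + j)) x = (S.phi ^ i) ((S.phi ^ j) x) := by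
  rw [zpow_add]; rfl

theorem zpow_succ_apply (i : ℤ) (x : X) : (S.phi ^ (i + 1)) x = S.phi ((S.phi ^ i) x) := by
  rw [add_comm, zpow_add_apply]; simp

theorem zpow_pred_apply (i : ℤ) (x : X) :
    (S.phi ^ (i - 1)) x = S.phi.symm ((S.phi ^ i) x) := by
  rw [sub_eq_neg_add, zpow_add_apply]; simp

theorem zpow_cont (i : ℤ) : Continuous (S.phi ^ i) := by
  induction i using Int.induction_on with
  | zero => simpa using continuous_id
  | succ n ih =>
    have : ⇑(S.phi ^ ((n : ℤ) + 1)) = S.phi ∘ (S.phi ^ (n : ℤ)) := by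
      ext x; exact S.zpow_succ_apply _ x
    rw [this]; exact S.phi_cont.comp ih
  | pred n ih =>
    have : ⇑(S.phi ^ (-(n : ℤ) - 1)) = S.phi.symm ∘ (S.phi ^ (-(n : ℤ))) := by
      ext x; exact S.zpow_pred_apply _ x
    rw [this]; exact S.phi_symm_cont.comp ih

/-- points whose orbit stays in the interiors -/
def good (P : Set (Set X)) : Set X := {x | ∀ i : ℤ, ∃ R ∈ P, (S.phi ^ i) x ∈ interior R}

/-- the colour of a point -/
noncomputable def col (P : Set (Set X)) (x : X) : Set X :=
  Classical.epsilon fun R => R ∈ P ∧ x ∈ interior R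

variable {S} {P : Set (Set X)} {e : ℝ}

theorem good_zpow {x : X} (hx : x ∈ S.good P) (i : ℤ) : (S.phi ^ i) x ∈ S.good P := by
  intro j
  have := hx (j + i)
  rwa [zpow_add_apply] at this

theorem col_spec {x : X} (hx : ∃ R ∈ P, x ∈ interior R) : col P x ∈ P ∧ x ∈ interior (col P x) :=
  Classical.epsilon_spec hx

theorem good_col {x : X} (hx : x ∈ S.good P) (i : ℤ) :
    col P ((S.phi ^ i) x) ∈ P ∧ (S.phi ^ i) x ∈ interior (col P ((S.phi ^ i) x)) :=
  col_spec (hx i)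

theorem good_col0 {x : X} (hx : x ∈ S.good P) : col P x ∈ P ∧ x ∈ interior (col P x) := by
  simpa using good_col hx 0

theorem MS.col_eq (M : S.MS P e) {x : X} (hx : x ∈ S.good P) {R : Set X} (hR : R ∈ P)
    (hxR : x ∈ R) : col P x = R := by
  obtain ⟨h1, h2⟩ := good_col0 hx
  rw [M.cl R hR] at hxR
  obtain ⟨y, hy1, hy2⟩ := mem_closure_iff.1 hxR _ isOpen_interior h2
  exact M.disj _ h1 _ hR y hy1 hy2

theorem MS.dense [CompactSpace X] (M : S.MS P e) : Dense (S.good P) := by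
  have h0 : Dense (⋃ R ∈ P, interior R) := by
    intro x
    obtain ⟨R, hR, hx⟩ := M.cov x
    rw [M.cl R hR] at hx
    exact closure_mono (subset_biUnion_of_mem (u := fun R => interior R) hR) hx
  have h1 : IsOpen (⋃ R ∈ P, interior R) := isOpen_biUnion fun _ _ => isOpen_interior
  have : S.good P = ⋂ i : ℤ, (S.phi ^ i) ⁻¹' (⋃ R ∈ P, interior R) := by
    ext x; simp [good]
  rw [this]
  refine dense_iInter_of_isOpen (fun i => h1.preimage (S.zpow_cont i)) fun i => ?_
  refine h0.preimage ?_
  let H : X ≃ₜ X := ⟨(S.phi ^ i), S.zpow_cont i, by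
    have := S.zpow_cont (-i)
    rw [zpow_neg] at this
    exact this⟩
  exact H.isOpenMap

theorem bracket_tendsto {x y : X} (hxy : dist x y < S.eps) {α : Type*} {l : Filter α}
    {f g : α → X} (hf : Filter.Tendsto f l (𝓝 x)) (hg : Filter.Tendsto g l (𝓝 y)) :
    Filter.Tendsto (fun a => S.bracket (f a) (g a)) l (𝓝 (S.bracket x y)) := by
  have h1 : {p : X × X | dist p.1 p.2 ≤ S.eps} ∈ 𝓝 (x, y) := by
    have : {p : X × X | dist p.1 p.2 < S.eps} ∈ 𝓝 (x, y) :=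
      (isOpen_lt (by fun_prop) continuous_const).mem_nhds hxy
    exact Filter.mem_of_superset this fun p hp => by
      simp only [mem_ofPred_eq] at hp ⊢; exact hp.le
  have h2 := (S.bracket_cont.continuousAt h1).tendsto
  exact h2.comp (hf.prodMk_nhds hg)

theorem MS.perturb [CompactSpace X] (M : S.MS P e) {x y : X} {R : Set X} (hR : R ∈ P)
    (hx : x ∈ interior R) (hy : y ∈ interior R) {Ox Oy : Set X} (hOx : Ox ∈ 𝓝 x) (hOy : Oy ∈ 𝓝 y) :
    ∃ q ∈ S.good P, ∃ x' ∈ Ox, ∃ y' ∈ Oy, x' ∈ interior R ∧ y' ∈ interior R ∧ q ∈ R ∧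
      q = S.bracket x' y' ∧ S.bracket x' q = q ∧ S.bracket q y' = q := by
  have hxR := interior_subset hx
  have hyR := interior_subset hy
  set p := S.bracket x y with hp
  have hpR : p ∈ R := M.br R hR x hxR y hyR
  have d : ∀ a ∈ R, ∀ b ∈ R, dist a b < S.eps := fun a ha b hb =>
    (M.small R hR a ha b hb).trans_lt M.elt
  have tq : Filter.Tendsto (fun q : X => q) (𝓝 p) (𝓝 p) := Filter.tendsto_id
  have tx : Filter.Tendsto (fun q => S.bracket q x) (𝓝 p) (𝓝 x) := by
    have := bracket_tendsto (d p hpR x hxR) tq (tendsto_const_nhds (x := x))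
    have e1 : S.bracket p x = x := by
      rw [hp, S.bracket_assoc₂ x y x (d _ hxR _ hyR).le (d _ hpR _ hxR).le (d _ hxR _ hxR).le,
        S.bracket_self]
    rwa [e1] at this
  have ty : Filter.Tendsto (fun q => S.bracket y q) (𝓝 p) (𝓝 y) := by
    have := bracket_tendsto (d y hyR p hpR) (tendsto_const_nhds (x := y)) tq
    have e1 : S.bracket y p = y := by
      rw [hp, S.bracket_assoc₁ y x y (d _ hxR _ hyR).le (d _ hyR _ hpR).le (d _ hyR _ hyR).le,
        S.bracket_self]
    rwa [e1] at this
  have ev : ∀ {f g : X → X} {a b : X}, a ∈ R → b ∈ R → Filter.Tendsto f (𝓝 p) (𝓝 a) →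
      Filter.Tendsto g (𝓝 p) (𝓝 b) → ∀ᶠ q in 𝓝 p, dist (f q) (g q) < S.eps := by
    intro f g a b ha hb hf hg
    exact (hf.dist hg).eventually (gt_mem_nhds (d a ha b hb))
  have E := ((tx.eventually hOx).and ((ty.eventually hOy).and
    ((tx.eventually (isOpen_interior.mem_nhds hx)).and
    ((ty.eventually (isOpen_interior.mem_nhds hy)).and
    ((ev hpR hxR tq tendsto_const_nhds).and
    ((ev hpR hyR tq tendsto_const_nhds).and
    ((ev hxR hyR tx ty).and ((ev hxR hpR tx tq).and (ev hyR hpR ty tq)))))))))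
  obtain ⟨q, hqG, hqE⟩ := M.dense.inter_nhds_nonempty E
  obtain ⟨q1, q2, q3, q4, q5, q6, q7, q8, q9⟩ := hqE
  have q6' : dist y q < S.eps := by rw [dist_comm]; exact q6
  have q9' : dist q (S.bracket y q) < S.eps := by rw [dist_comm]; exact q9
  have hq : q = S.bracket (S.bracket q x) (S.bracket y q) := by
    rw [S.bracket_assoc₁ _ y q q6'.le q7.le q8.le,
      S.bracket_assoc₂ q x q q5.le q8.le (by simpa using S.eps_pos.le), S.bracket_self]
  have hqR : q ∈ R := by
    rw [hq]; exact M.br R hR _ (interior_subset q3) _ (interior_subset q4)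
  refine ⟨q, hqG, _, q1, _, q2, q3, q4, hqR, hq, ?_, ?_⟩
  · rw [S.bracket_assoc₂ q x q q5.le q8.le (by simpa using S.eps_pos.le), S.bracket_self]
  · rw [S.bracket_assoc₁ q y q q6'.le q9'.le (by simpa using S.eps_pos.le), S.bracket_self]

end SmaleSpace

open Set Metric MeasureTheory Topology
open scoped ENNReal NNReal

namespace SmaleSpace

variable {X : Type*} [MetricSpace X] {S : SmaleSpace X} {P : Set (Set X)} {e : ℝ}

theorem inv_zpow (i : ℤ) : S.inv.phi ^ i = S.phi ^ (-i) := by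
  simp [SmaleSpace.inv]

theorem zpow_neg_cancel (i : ℤ) (x : X) : (S.phi ^ (-i)) ((S.phi ^ i) x) = x := by
  rw [← zpow_add_apply]; simp

theorem zpow_cancel_neg (i : ℤ) (x : X) : (S.phi ^ i) ((S.phi ^ (-i)) x) = x := by
  rw [← zpow_add_apply]; simp

theorem MS.fwd_iter (M : S.MS P e) {w : ℤ → Set X} (hw : ∀ i, w i ∈ P) {x z : X} {n : ℕ}
    (hx : ∀ i : ℕ, i ≤ n → (S.phi ^ (i : ℤ)) x ∈ interior (w i)) (hz : z ∈ w 0)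
    (hb : S.bracket x z = z) (i : ℕ) (hi : i ≤ n) : (S.phi ^ (i : ℤ)) z ∈ w i ∧
      S.bracket ((S.phi ^ (i : ℤ)) x) ((S.phi ^ (i : ℤ)) z) = (S.phi ^ (i : ℤ)) z := by
  induction i with
  | zero => simpa using ⟨hz, hb⟩
  | succ i ih =>
    obtain ⟨h1, h2⟩ := ih (by omega)
    have h3 := hx (i + 1) hi
    push_cast at h3 ⊢
    rw [zpow_succ_apply] at h3
    rw [zpow_succ_apply, zpow_succ_apply]
    exact M.fwd _ (hw _) _ (hw _) _ (hx i (by omega)) h3 _ h1 h2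

theorem MS.bwd_iter (M : S.MS P e) {w : ℤ → Set X} (hw : ∀ i, w i ∈ P) {x z : X} {n : ℕ}
    (hx : ∀ i : ℕ, i ≤ n → (S.phi ^ (-(i : ℤ))) x ∈ interior (w (-i))) (hz : z ∈ w 0)
    (hb : S.bracket z x = z) (i : ℕ) (hi : i ≤ n) : (S.phi ^ (-(i : ℤ))) z ∈ w (-i) := by
  have := M.inv.fwd_iter (w := fun i => w (-i)) (fun i => hw _) (x := x) (z := z) (n := n)
    (fun i hi => by rw [inv_zpow]; exact hx i hi) (by simpa using hz) hb i hi
  rw [inv_zpow] at this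
  exact this.1

theorem good_nhds {x : X} (hx : x ∈ S.good P) (a b : ℤ) :
    {x' | ∀ i : ℤ, a ≤ i → i ≤ b → (S.phi ^ i) x' ∈ interior (col P ((S.phi ^ i) x))} ∈ 𝓝 x := by
  have : {x' | ∀ i : ℤ, a ≤ i → i ≤ b → (S.phi ^ i) x' ∈ interior (col P ((S.phi ^ i) x))} =
      ⋂ i ∈ Finset.Icc a b, (S.phi ^ i) ⁻¹' (interior (col P ((S.phi ^ i) x))) := by
    ext; simp
  rw [this, Filter.biInter_finset_mem]
  intro i _
  exact (isOpen_interior.preimage (S.zpow_cont i)).mem_nhds (good_col hx i).2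

theorem MS.glue [CompactSpace X] (M : S.MS P e) {x y : X} (hx : x ∈ S.good P) (hy : y ∈ S.good P)
    (hc : col P x = col P y) (m n : ℕ) : ∃ z ∈ S.good P,
      (∀ i : ℤ, -m ≤ i → i ≤ 0 → col P ((S.phi ^ i) z) = col P ((S.phi ^ i) x)) ∧
      (∀ i : ℤ, 0 ≤ i → i ≤ n → col P ((S.phi ^ i) z) = col P ((S.phi ^ i) y)) := by
  obtain ⟨hxP, hxi⟩ := good_col0 hx
  obtain ⟨hyP, hyi⟩ := good_col0 hy
  obtain ⟨q, hq, y', hy', x', hx', -, -, hqR, hqe, hs, hu⟩ :=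
    M.perturb hyP hyi (hc ▸ hxi) (good_nhds hy 0 n) (good_nhds hx (-m) 0)
  refine ⟨q, hq, ?_, ?_⟩
  · intro i h1 h2
    obtain ⟨j, rfl⟩ : ∃ j : ℕ, i = -(j : ℤ) := ⟨i.natAbs, by omega⟩
    refine M.col_eq (good_zpow hq _) (good_col hx _).1 ?_
    exact M.bwd_iter (w := fun i => col P ((S.phi ^ i) x)) (fun i => (good_col hx i).1)
      (n := m) (fun i hi => hx' _ (by omega) (by omega)) (by simpa [hc] using hqR) hu j (by omega)
  · intro i h1 h2
    obtain ⟨j, rfl⟩ : ∃ j : ℕ, i = (j : ℤ) := ⟨i.natAbs, by omega⟩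
    refine M.col_eq (good_zpow hq _) (good_col hy _).1 ?_
    exact (M.fwd_iter (w := fun i => col P ((S.phi ^ i) y)) (fun i => (good_col hy i).1)
      (n := n) (fun i hi => hy' _ (by omega) (by omega)) (by simpa using hqR) hs j (by omega)).1

theorem bracket_iter {x y : X} (n : ℕ)
    (hd : ∀ i : ℕ, i ≤ n → dist ((S.phi ^ (i : ℤ)) x) ((S.phi ^ (i : ℤ)) y) ≤ S.eps) :
    (S.phi ^ (n : ℤ)) (S.bracket x y) = S.bracket ((S.phi ^ (n : ℤ)) x) ((S.phi ^ (n : ℤ)) y) := by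
  induction n with
  | zero => simp
  | succ n ih =>
    have h1 := hd n (by omega)
    have h2 := hd (n + 1) le_rfl
    push_cast at h2 ⊢
    rw [zpow_succ_apply, zpow_succ_apply] at h2
    rw [zpow_succ_apply, zpow_succ_apply, zpow_succ_apply, ih fun i hi => hd i (by omega),
      S.bracket_phi _ _ h1 h2]

theorem MS.bowen [CompactSpace X] (M : S.MS P e) {x y : X} (hx : x ∈ S.good P) (hy : y ∈ S.good P)
    (n : ℕ) (hc : col P x = col P y)
    (hc' : col P ((S.phi ^ (n : ℤ)) x) = col P ((S.phi ^ (n : ℤ)) y))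
    (hd : ∀ i : ℕ, i ≤ n → dist ((S.phi ^ (i : ℤ)) x) ((S.phi ^ (i : ℤ)) y) < S.eps / 2)
    (i : ℕ) (hi : i ≤ n) :
    col P ((S.phi ^ (i : ℤ)) x) = col P ((S.phi ^ (i : ℤ)) y) := by
  obtain ⟨hxP, hxi⟩ := good_col0 hx
  obtain ⟨hyP, hyi⟩ := good_col0 hy
  have near : ∀ x : X, {x' | ∀ i : ℕ, i ≤ n →
      dist ((S.phi ^ (i : ℤ)) x') ((S.phi ^ (i : ℤ)) x) < S.eps / 4} ∈ 𝓝 x := by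
    intro x
    have : {x' | ∀ i : ℕ, i ≤ n →
      dist ((S.phi ^ (i : ℤ)) x') ((S.phi ^ (i : ℤ)) x) < S.eps / 4} =
      ⋂ i ∈ Finset.Iic n, (S.phi ^ (i : ℤ)) ⁻¹' (ball ((S.phi ^ (i : ℤ)) x) (S.eps / 4)) := by
      ext; simp
    rw [this, Filter.biInter_finset_mem]
    intro i _
    exact (isOpen_ball.preimage (S.zpow_cont i)).mem_nhds
      (mem_ball_self (by linarith [S.eps_pos]))
  obtain ⟨q, hq, x', hx', y', hy', -, -, hqR, hqe, hs, hu⟩ :=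
    M.perturb hyP (hc ▸ hxi) hyi (Filter.inter_mem (good_nhds hx 0 n) (near x))
      (Filter.inter_mem (good_nhds hy 0 n) (near y))
  have hdd : ∀ i : ℕ, i ≤ n → dist ((S.phi ^ (i : ℤ)) x') ((S.phi ^ (i : ℤ)) y') < S.eps := by
    intro i hi
    have a1 := hx'.2 i hi
    have a2 := hy'.2 i hi
    rw [dist_comm] at a2
    have a3 := hd i hi
    have := dist_triangle4 ((S.phi ^ (i : ℤ)) x') ((S.phi ^ (i : ℤ)) x) ((S.phi ^ (i : ℤ)) y)
      ((S.phi ^ (i : ℤ)) y')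
    linarith
  have hqn := bracket_iter n fun i hi => (hdd i hi).le
  rw [← hqe] at hqn
  have k1 : col P ((S.phi ^ (i : ℤ)) q) = col P ((S.phi ^ (i : ℤ)) x) := by
    refine M.col_eq (good_zpow hq _) (good_col hx _).1 ?_
    exact (M.fwd_iter (w := fun i => col P ((S.phi ^ i) x)) (fun i => (good_col hx i).1)
      (n := n) (fun i hi => hx'.1 _ (by omega) (by omega)) (by simpa [hc] using hqR) hs i hi).1
  have k2 : col P ((S.phi ^ (i : ℤ)) q) = col P ((S.phi ^ (i : ℤ)) y) := by
    refine M.col_eq (good_zpow hq _) (good_col hy _).1 ?_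
    have hyn := hy'.1 n (by omega) le_rfl
    have hxn := hx'.1 n (by omega) le_rfl
    have hmem : (S.phi ^ (n : ℤ)) q ∈ col P ((S.phi ^ (n : ℤ)) y) := by
      rw [hqn]
      exact M.br _ (good_col hy _).1 _ (hc' ▸ interior_subset hxn) _ (interior_subset hyn)
    have := M.bwd_iter (w := fun i => col P ((S.phi ^ (i + n)) y)) (fun i => (good_col hy _).1)
      (x := (S.phi ^ (n : ℤ)) y') (z := (S.phi ^ (n : ℤ)) q)
      (n := n) (fun i hi => by
        rw [← zpow_add_apply]; exact hy'.1 _ (by omega) (by omega)) (by simpa using hmem) (by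
        have hR : ∀ a ∈ col P ((S.phi ^ (n : ℤ)) y), ∀ b ∈ col P ((S.phi ^ (n : ℤ)) y),
            dist a b ≤ S.eps := fun a ha b hb =>
          (M.small _ (good_col hy _).1 a ha b hb).trans M.elt.le
        rw [hqn]
        rw [hqn] at hmem
        have hy0 := interior_subset hyn
        exact S.bracket_assoc₂ _ _ _ (hdd n le_rfl).le (hR _ hmem _ hy0) (hdd n le_rfl).le)
        (n - i) (by omega)
    rw [← zpow_add_apply] at this
    have e1 : -((n - i : ℕ) : ℤ) + n = i := by omega
    rw [e1] at this
    exact this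
  rw [← k1, k2]

theorem stable_iter {x z : X} (hb : S.bracket x z = z) (hd : dist x z < S.eps) (n : ℕ) :
    S.bracket ((S.phi ^ (n : ℤ)) x) ((S.phi ^ (n : ℤ)) z) = (S.phi ^ (n : ℤ)) z ∧
    dist ((S.phi ^ (n : ℤ)) x) ((S.phi ^ (n : ℤ)) z) ≤ (S.lam⁻¹) ^ n * dist x z := by
  have hl := S.one_lt_lam
  have hl0 : 0 < S.lam⁻¹ := by positivity
  have hl1 : S.lam⁻¹ < 1 := inv_lt_one_of_one_lt₀ hl
  induction n with
  | zero => simpa using hb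
  | succ n ih =>
    obtain ⟨h1, h2⟩ := ih
    have h3 : (S.lam⁻¹) ^ n * dist x z ≤ dist x z :=
      mul_le_of_le_one_left dist_nonneg (pow_le_one₀ hl0.le hl1.le)
    have h4 := S.contract_s _ S.eps S.eps_pos le_rfl ((S.phi ^ (n : ℤ)) x) ((S.phi ^ (n : ℤ)) z)
      (by simpa using S.eps_pos) (S.bracket_self _) (by linarith) h1
    have h5 : dist (S.phi ((S.phi ^ (n : ℤ)) x)) (S.phi ((S.phi ^ (n : ℤ)) z)) ≤
        (S.lam⁻¹) ^ (n + 1) * dist x z := by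
      refine h4.trans ?_
      rw [pow_succ', mul_assoc]
      gcongr
    push_cast
    rw [zpow_succ_apply, zpow_succ_apply]
    refine ⟨?_, h5⟩
    have h6 : (S.lam⁻¹) ^ (n + 1) * dist x z ≤ dist x z :=
      mul_le_of_le_one_left dist_nonneg (pow_le_one₀ hl0.le hl1.le)
    rw [← S.bracket_phi _ _ (by linarith) (by linarith), h1]

theorem MS.half_contr (M : S.MS P e) {x y : X} {w : ℤ → Set X} (hw : ∀ i, w i ∈ P) (n : ℕ)
    (hx : ∀ i : ℤ, -n ≤ i → i ≤ 0 → (S.phi ^ i) x ∈ w i)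
    (hy : ∀ i : ℤ, -n ≤ i → i ≤ 0 → (S.phi ^ i) y ∈ w i) :
    dist x (S.bracket x y) ≤ (S.lam⁻¹) ^ n * e := by
  have hl := S.one_lt_lam
  set a := (S.phi ^ (-(n : ℤ))) x with ha
  set b := (S.phi ^ (-(n : ℤ))) y with hb
  have hxa : (S.phi ^ (n : ℤ)) a = x := zpow_cancel_neg _ _
  have hyb : (S.phi ^ (n : ℤ)) b = y := zpow_cancel_neg _ _
  have haw : a ∈ w (-n) := hx _ le_rfl (by omega)
  have hbw : b ∈ w (-n) := hy _ le_rfl (by omega)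
  have h1 := bracket_iter (S := S) (x := a) (y := b) n (by
    intro i hi
    rw [ha, hb, ← zpow_add_apply, ← zpow_add_apply]
    exact (M.small _ (hw (i + -n)) _ (hx _ (by omega) (by omega)) _
      (hy _ (by omega) (by omega))).trans M.elt.le)
  have hz := M.br _ (hw _) _ haw _ hbw
  have d1 := M.small _ (hw _) _ haw _ hz
  have d2 := M.small _ (hw _) _ haw _ hbw
  have h2 := (stable_iter (S := S) (x := a) (z := S.bracket a b)
    (S.bracket_assoc₁ _ _ _ (d2.trans M.elt.le) (d1.trans M.elt.le) (d2.trans M.elt.le))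
    (d1.trans_lt M.elt) n).2
  rw [h1, hxa, hyb] at h2
  refine h2.trans ?_
  gcongr

theorem MS.contr (M : S.MS P e) {x y : X} {w : ℤ → Set X} (hw : ∀ i, w i ∈ P) (n : ℕ)
    (hx : ∀ i : ℤ, -n ≤ i → i ≤ n → (S.phi ^ i) x ∈ w i)
    (hy : ∀ i : ℤ, -n ≤ i → i ≤ n → (S.phi ^ i) y ∈ w i) :
    dist x y ≤ 2 * e * (S.lam⁻¹) ^ n := by
  have h1 := M.half_contr hw n (fun i h1 h2 => hx i h1 (by omega))
    (fun i h1 h2 => hy i h1 (by omega))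
  have h2 := M.inv.half_contr (x := y) (y := x) (w := fun i => w (-i)) (fun i => hw _) n
    (fun i h1 h2 => by rw [inv_zpow]; exact hy _ (by omega) (by omega))
    (fun i h1 h2 => by rw [inv_zpow]; exact hx _ (by omega) (by omega))
  change dist y (S.bracket x y) ≤ (S.lam⁻¹) ^ n * e at h2
  have := dist_triangle_right x y (S.bracket x y)
  linarith

theorem MS.spec [CompactSpace X] (M : S.MS P e) (hmix : MixingSystem ⇑S.phi) :
    ∃ K : ℕ, 1 ≤ K ∧ ∀ x ∈ S.good P, ∀ y ∈ S.good P, ∀ m n : ℕ, ∃ z ∈ S.good P,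
      (∀ i : ℤ, 0 ≤ i → i ≤ m → col P ((S.phi ^ i) z) = col P ((S.phi ^ i) x)) ∧
      (∀ i : ℤ, 0 ≤ i → i ≤ n → col P ((S.phi ^ (m + K + i)) z) = col P ((S.phi ^ i) y)) := by
  have h1 : ∃ K : ℕ, 1 ≤ K ∧ ∀ a ∈ P, ∀ b ∈ P, ∃ t ∈ S.good P, col P t = a ∧
      col P ((S.phi ^ (K : ℤ)) t) = b := by
    have h2 : ∀ a ∈ P, ∀ b ∈ P, ∃ N : ℕ, ∀ n ≥ N, ∃ t ∈ S.good P, col P t = a ∧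
      col P ((S.phi ^ (n : ℤ)) t) = b := by
      intro a ha b hb
      have nea : ∀ a ∈ P, (interior a).Nonempty := by
        intro a ha
        by_contra hne
        rw [not_nonempty_iff_eq_empty] at hne
        have := M.cl a ha
        rw [hne, closure_empty] at this
        exact (M.ne a ha).ne_empty this
      obtain ⟨N, hN⟩ := hmix _ _ (isOpen_interior (s := a)) (isOpen_interior (s := b))
        (nea a ha) (nea b hb)
      refine ⟨N, fun n hn => ?_⟩
      obtain ⟨_, ⟨u, hu, rfl⟩, hu2⟩ := hN n hn
      have e1 : ∀ u, (S.phi ^ (n : ℤ)) u = S.phi^[n] u := by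
        intro u
        rw [zpow_natCast, Equiv.Perm.iterate_eq_pow]
      have ho : IsOpen (interior a ∩ (S.phi ^ (n : ℤ)) ⁻¹' (interior b)) :=
        isOpen_interior.inter (isOpen_interior.preimage (S.zpow_cont _))
      obtain ⟨t, ht, htg⟩ := M.dense.inter_open_nonempty _ ho ⟨u, hu, by
        rw [mem_preimage, e1]; exact hu2⟩
      exact ⟨t, htg, M.col_eq htg ha (interior_subset ht.1),
        M.col_eq (good_zpow htg _) hb (interior_subset ht.2)⟩
    choose! N hN using h2
    have hbd : ∃ K : ℕ, ∀ p ∈ P ×ˢ P, N p.1 p.2 ≤ K := by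
      obtain ⟨K, hK⟩ := ((M.fin.prod M.fin).image (fun p => N p.1 p.2)).bddAbove
      exact ⟨K, fun p hp => hK (mem_image_of_mem _ hp)⟩
    obtain ⟨K, hK⟩ := hbd
    exact ⟨K + 1, by omega, fun a ha b hb => hN a ha b hb _ (by
      have := hK (a, b) ⟨ha, hb⟩; simp only at this; omega)⟩
  obtain ⟨K, hK1, hK⟩ := h1
  refine ⟨K, hK1, fun x hx y hy m n => ?_⟩
  obtain ⟨t, ht, ht1, ht2⟩ := hK _ (good_col hx m).1 _ (good_col0 hy).1
  obtain ⟨z, hz, hz1, hz2⟩ := M.glue (good_zpow hx m) ht ht1.symm m K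
  obtain ⟨q, hq, hq1, hq2⟩ := M.glue (good_zpow hz K) hy (by
    rw [hz2 K (by omega) le_rfl, ht2]) (K + m) n
  refine ⟨_, good_zpow hq (-(K + m)), fun i h1 h2 => ?_, fun i h1 h2 => ?_⟩
  · have a1 := hq1 (i + -(K + m)) (by push_cast; omega) (by omega)
    have a2 := hz1 (i + -m) (by omega) (by omega)
    rw [← zpow_add_apply] at a1 a2
    rw [← zpow_add_apply, a1]
    have e1 : i + -(K + m : ℤ) + K = i + -m := by ring
    rw [e1, a2]
    simp
  · rw [← zpow_add_apply, ← hq2 i h1 h2]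
    congr 3
    ring

end SmaleSpace

open Set Metric MeasureTheory Topology
open scoped ENNReal NNReal

namespace SmaleSpace

theorem finite_of_codes {X β : Type*} [MetricSpace X] (A : Set X) (M : ℕ)
    (H : ∀ δ > 0, ∃ f : X → β, (f '' A).Finite ∧ (f '' A).ncard ≤ M ∧
      ∀ x ∈ A, ∀ y ∈ A, f x = f y → dist x y < δ) : A.Finite := by
  classical
  by_contra hA
  obtain ⟨s, hs, hsc⟩ := (show A.Infinite from hA).exists_subset_card_eq (M + 1)
  have hδ : ∃ δ > 0, ∀ x ∈ s, ∀ y ∈ s, x ≠ y → δ ≤ dist x y := by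
    rcases Finset.eq_empty_or_nonempty
      (((s ×ˢ s).filter fun p => p.1 ≠ p.2).image (fun p => dist p.1 p.2)) with h | h
    rotate_left
    · refine ⟨Finset.min' _ h, ?_, fun x hx y hy hxy => Finset.min'_le _ _ ?_⟩
      rotate_right
      · exact Finset.mem_image.2 ⟨(x, y), by simp [hx, hy, hxy], rfl⟩
      · have := Finset.min'_mem _ h
        obtain ⟨p, hp, hpe⟩ := Finset.mem_image.1 this
        simp only [Finset.mem_filter] at hp
        rw [gt_iff_lt, ← hpe]
        exact dist_pos.2 hp.2
    · refine ⟨1, one_pos, fun x hx y hy hxy => ((Finset.eq_empty_iff_forall_notMem.1 h) _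
        (Finset.mem_image.2 ⟨(x, y), ?_, rfl⟩)).elim⟩
      simp [hx, hy, hxy]
  obtain ⟨δ, hδ0, hδ⟩ := hδ
  obtain ⟨f, hf1, hf2, hf3⟩ := H δ hδ0
  have hcard : hf1.toFinset.card < s.card := by
    rw [← Set.ncard_eq_toFinset_card _ hf1]; omega
  obtain ⟨x, hx, y, hy, hxy, hfe⟩ := Finset.exists_ne_map_eq_of_card_lt_of_maps_to hcard (f := f)
    (fun x hx => by simpa using ⟨x, hs hx, rfl⟩)
  exact absurd (hf3 x (hs hx) y (hs hy) hfe) (not_lt.2 (hδ x hx y hy hxy))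

theorem infinite_of_mixing {X : Type*} [MetricSpace X] [Nontrivial X] {f : X → X}
    (hmix : MixingSystem f) : Infinite X := by
  by_contra hfin
  rw [not_infinite_iff_finite] at hfin
  obtain ⟨x, y, hxy⟩ := exists_pair_ne X
  obtain ⟨N1, h1⟩ := hmix {x} {x} (isOpen_discrete _) (isOpen_discrete _) (by simp) (by simp)
  obtain ⟨N2, h2⟩ := hmix {x} {y} (isOpen_discrete _) (isOpen_discrete _) (by simp) (by simp)
  have a := h1 (N1 + N2) (by omega)
  have b := h2 (N1 + N2) (by omega)
  simp at a b
  exact hxy (a.trans b.symm)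

variable {X : Type*} [MetricSpace X] {S : SmaleSpace X} {P : Set (Set X)} {e : ℝ}

variable (S P) in
/-- The element of the `n+1`-st partition around a good point. -/
def rset (n : ℕ) (x : X) : Set X :=
  ⋂ i ∈ Finset.Icc (-(n : ℤ)) (n : ℤ), (⇑(S.phi ^ i)) ⁻¹' (col P ((S.phi ^ i) x))

theorem mem_rset {n : ℕ} {x y : X} : y ∈ S.rset P n x ↔
    ∀ i : ℤ, -n ≤ i → i ≤ n → (S.phi ^ i) y ∈ col P ((S.phi ^ i) x) := by
  simp [rset]

theorem self_mem_rset {n : ℕ} {x : X} (hx : x ∈ S.good P) : x ∈ S.rset P n x :=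
  mem_rset.2 fun i _ _ => interior_subset (good_col hx i).2

theorem rset_nhds {n : ℕ} {x : X} (hx : x ∈ S.good P) : S.rset P n x ∈ 𝓝 x := by
  refine Filter.mem_of_superset (good_nhds hx (-n) n) fun y hy => ?_
  exact mem_rset.2 fun i h1 h2 => interior_subset (hy i h1 h2)

theorem rset_mem {n : ℕ} {x : X} (hx : x ∈ S.good P) : S.rset P n x ∈ S.markovSeq P (n + 1) :=
  ⟨⟨x, mem_interior_iff_mem_nhds.2 (rset_nhds hx)⟩, fun i => col P ((S.phi ^ i) x),
    fun i => (good_col hx i).1, rfl⟩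

theorem MS.rset_closed (M : S.MS P e) {n : ℕ} {x : X} (hx : x ∈ S.good P) :
    IsClosed (S.rset P n x) :=
  isClosed_biInter fun i _ => (M.closed _ (good_col hx i).1).preimage (S.zpow_cont i)

theorem MS.col_of_mem_rset (M : S.MS P e) {n : ℕ} {x y : X} (hx : x ∈ S.good P)
    (hy : y ∈ S.good P) (h : y ∈ S.rset P n x) (i : ℤ) (h1 : -n ≤ i) (h2 : i ≤ n) :
    col P ((S.phi ^ i) y) = col P ((S.phi ^ i) x) :=
  M.col_eq (good_zpow hy i) (good_col hx i).1 (mem_rset.1 h i h1 h2)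

theorem MS.markov_rset [CompactSpace X] (M : S.MS P e) {n : ℕ} {R : Set X}
    (hR : R ∈ S.markovSeq P (n + 1)) : ∃ x ∈ S.good P, R = S.rset P n x := by
  obtain ⟨hne, g, hg, hRe⟩ := hR
  obtain ⟨x, hx, hxg⟩ := M.dense.inter_open_nonempty _ isOpen_interior hne
  refine ⟨x, hxg, ?_⟩
  have hx' := interior_subset hx
  rw [hRe] at hx'
  rw [hRe, rset]
  simp only [mem_iInter] at hx'
  refine iInter₂_congr fun i hi => ?_
  rw [M.col_eq (good_zpow hxg i) (hg i) (hx' i hi)]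

theorem MS.markov_finite (M : S.MS P e) (n : ℕ) : (S.markovSeq P n).Finite := by
  cases n with
  | zero => exact finite_singleton _
  | succ n =>
    have h1 : {g : ↥(Finset.Icc (-(n : ℤ)) (n : ℤ)) → Set X | ∀ i, g i ∈ P}.Finite :=
      Set.Finite.pi' fun _ => M.fin
    refine (h1.image fun g => ⋂ i : ↥(Finset.Icc (-(n : ℤ)) (n : ℤ)), (⇑(S.phi ^ (i : ℤ))) ⁻¹' (g i)).subset ?_
    rintro R ⟨-, g, hg, rfl⟩
    refine ⟨fun i => g i, fun i => hg i, ?_⟩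
    ext x; simp

theorem MS.rset_cover [CompactSpace X] (M : S.MS P e) (n : ℕ) (z : X) :
    ∃ x ∈ S.good P, z ∈ S.rset P n x := by
  have hc : IsClosed (⋃ R ∈ S.markovSeq P (n + 1), R) := by
    refine (M.markov_finite _).isClosed_biUnion fun R hR => ?_
    obtain ⟨x, hx, rfl⟩ := M.markov_rset hR
    exact M.rset_closed hx
  have hd : S.good P ⊆ ⋃ R ∈ S.markovSeq P (n + 1), R := fun x hx =>
    mem_biUnion (rset_mem hx) (self_mem_rset hx)
  have := hc.closure_subset_iff.2 hd (M.dense z)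
  simp only [mem_iUnion] at this
  obtain ⟨R, hR, hz⟩ := this
  obtain ⟨x, hx, rfl⟩ := M.markov_rset hR
  exact ⟨x, hx, hz⟩

theorem MS.rset_dist (M : S.MS P e) {n : ℕ} {x y z : X} (hx : x ∈ S.good P)
    (hy : y ∈ S.rset P n x) (hz : z ∈ S.rset P n x) : dist y z ≤ 2 * e * (S.lam⁻¹) ^ n :=
  M.contr (w := fun i => col P ((S.phi ^ i) x)) (fun i => (good_col hx i).1) n
    (mem_rset.1 hy) (mem_rset.1 hz)

theorem MS.markov_diam [CompactSpace X] (M : S.MS P e) {n : ℕ} {R : Set X}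
    (hR : R ∈ S.markovSeq P (n + 1)) : diam R ≤ 2 * e * (S.lam⁻¹) ^ n := by
  obtain ⟨x, hx, rfl⟩ := M.markov_rset hR
  have := S.one_lt_lam
  have := M.epos
  exact diam_le_of_forall_dist_le (by positivity) fun y hy z hz => M.rset_dist hx hy hz

theorem lam_pow_small (S : SmaleSpace X) (c : ℝ) {δ : ℝ} (hδ : 0 < δ) :
    ∃ n : ℕ, c * (S.lam⁻¹) ^ n < δ := by
  have h1 := tendsto_pow_atTop_nhds_zero_of_lt_one (inv_nonneg.2 (zero_lt_one.trans S.one_lt_lam).le)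
    (inv_lt_one_of_one_lt₀ S.one_lt_lam)
  have h2 := h1.const_mul c
  rw [mul_zero] at h2
  exact (h2.eventually (gt_mem_nhds hδ)).exists

theorem MS.exists_unstable [CompactSpace X] [Infinite X] (M : S.MS P e) :
    ∃ y ∈ S.good P, ∃ p ∈ col P y, S.bracket p y = p ∧ p ≠ y := by
  classical
  by_contra! H
  have key : ∀ A ∈ P, ∀ z ∈ A, ∀ z' ∈ A, S.bracket z z' = z' := by
    intro A hA z hz z' hz'
    have hne : (interior A).Nonempty := by
      by_contra hne
      rw [not_nonempty_iff_eq_empty] at hne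
      have := M.cl A hA
      rw [hne, closure_empty] at this
      exact (M.ne A hA).ne_empty this
    obtain ⟨y, hy, hyg⟩ := M.dense.inter_open_nonempty _ isOpen_interior hne
    have hyA := interior_subset hy
    have d : ∀ a ∈ A, ∀ b ∈ A, dist a b ≤ S.eps := fun a ha b hb =>
      (M.small A hA a ha b hb).trans M.elt.le
    have hcol := M.col_eq hyg hA hyA
    have k : ∀ z ∈ A, S.bracket z y = y := by
      intro z hz
      refine H y hyg _ (hcol ▸ M.br A hA z hz y hyA) ?_
      exact S.bracket_assoc₂ z y y (d _ hz _ hyA) (d _ (M.br A hA z hz y hyA) _ hyA) (d _ hz _ hyA)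
    have l : ∀ z ∈ A, S.bracket z z' = S.bracket y z' := by
      intro z hz
      have := S.bracket_assoc₂ z y z' (d _ hz _ hyA) (d _ (M.br A hA z hz y hyA) _ hz')
        (d _ hz _ hz')
      rw [← this, k z hz]
    rw [l z hz, ← l z' hz', S.bracket_self]
  choose r hr1 hr2 using M.cov
  have : (Set.univ : Set X).Finite := by
    refine finite_of_codes (β := Set X) _ P.ncard fun δ hδ => ?_
    obtain ⟨n, hn⟩ := lam_pow_small S e hδ
    have hsub : (fun x => r ((S.phi ^ (-(n : ℤ))) x)) '' univ ⊆ P := by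
      rintro _ ⟨x, -, rfl⟩; exact hr1 _
    refine ⟨fun x => r ((S.phi ^ (-(n : ℤ))) x), M.fin.subset hsub, ncard_le_ncard hsub M.fin, ?_⟩
    intro x _ y _ hxy
    have hx := hr2 ((S.phi ^ (-(n : ℤ))) x)
    have hy := hr2 ((S.phi ^ (-(n : ℤ))) y)
    simp only at hxy
    rw [← hxy] at hy
    have hd := M.small _ (hr1 _) _ hx _ hy
    have := (stable_iter (key _ (hr1 _) _ hx _ hy) (hd.trans_lt M.elt) n).2
    rw [zpow_cancel_neg, zpow_cancel_neg] at this
    refine this.trans_lt (lt_of_le_of_lt ?_ hn)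
    have := S.one_lt_lam
    rw [mul_comm]
    gcongr
  exact Set.infinite_univ this

theorem MS.diam_lower_aux [CompactSpace X] [Infinite X] (M : S.MS P e)
    (hL : ∀ x y, dist (S.phi x) (S.phi y) ≤ S.lam * dist x y) :
    ∃ c > 0, ∀ n : ℕ, ∃ R ∈ S.markovSeq P (n + 1), c * (S.lam⁻¹) ^ n ≤ diam R := by
  obtain ⟨y, hy, p, hp, hb, hne⟩ := M.exists_unstable
  have hl : 0 < S.lam := zero_lt_one.trans S.one_lt_lam
  refine ⟨dist p y, dist_pos.2 hne, fun n => ⟨_, rset_mem (good_zpow hy (-(n : ℤ))), ?_⟩⟩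
  have h1 : (S.phi ^ (-(n : ℤ))) p ∈ S.rset P n ((S.phi ^ (-(n : ℤ))) y) := by
    rw [mem_rset]
    intro i h1 h2
    rw [← zpow_add_apply, ← zpow_add_apply]
    have := M.bwd_iter (w := fun i => col P ((S.phi ^ i) y)) (fun i => (good_col hy i).1)
      (x := y) (z := p) (n := 2 * n) (fun i _ => (good_col hy _).2) (by simpa using hp) hb
      (n - i).toNat (by omega)
    have e1 : -(((n : ℤ) - i).toNat : ℤ) = i + -n := by omega
    rwa [e1] at this
  have h2 := self_mem_rset (n := n) (good_zpow hy (-(n : ℤ)))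
  have h3 := dist_le_diam_of_mem isBounded_of_compactSpace h1 h2
  refine le_trans ?_ h3
  have h4 : ∀ n : ℕ, ∀ a b : X, dist ((S.phi ^ (n : ℤ)) a) ((S.phi ^ (n : ℤ)) b) ≤
      S.lam ^ n * dist a b := by
    intro n a b
    induction n with
    | zero => simp
    | succ n ih =>
      push_cast
      rw [zpow_succ_apply, zpow_succ_apply, pow_succ', mul_assoc]
      exact (hL _ _).trans (by gcongr)
  have := h4 n ((S.phi ^ (-(n : ℤ))) p) ((S.phi ^ (-(n : ℤ))) y)
  rw [zpow_cancel_neg, zpow_cancel_neg] at this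
  rw [inv_pow, ← div_eq_mul_inv, div_le_iff₀ (by positivity)]
  linarith

theorem lip_of_lipConst {f : X → X} {K : ℝ} (hK : 0 ≤ K)
    (h : lipConst f = ENNReal.ofReal K) (x y : X) : dist (f x) (f y) ≤ K * dist x y := by
  have h1 : edist (f x) (f y) ≤ ENNReal.ofReal K * edist x y := by
    rw [← h, lipConst]
    rcases eq_or_ne x y with rfl | hxy
    · simp
    rw [← ENNReal.div_le_iff (by simpa using hxy) (edist_ne_top _ _)]
    refine le_sInf fun L hL => ?_
    rw [ENNReal.div_le_iff (by simpa using hxy) (edist_ne_top _ _)]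
    exact hL x y
  rw [edist_dist, edist_dist, ← ENNReal.ofReal_mul hK] at h1
  exact (ENNReal.ofReal_le_ofReal_iff (by positivity)).1 h1

theorem nontrivial_of_sc
    (hsc : ENNReal.ofReal S.lam = min (lipConst ⇑S.phi) (lipConst ⇑S.phi.symm)) :
    Nontrivial X := by
  by_contra hn
  rw [not_nontrivial_iff_subsingleton] at hn
  have : lipConst ⇑S.phi = 0 := by
    refine le_antisymm (sInf_le fun x y => ?_) zero_le
    rw [Subsingleton.elim x y]; simp
  rw [this] at hsc
  simp at hsc
  linarith [S.one_lt_lam]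

theorem MS.diam_lower [CompactSpace X] [Infinite X] (M : S.MS P e)
    (hsc : ENNReal.ofReal S.lam = min (lipConst ⇑S.phi) (lipConst ⇑S.phi.symm)) :
    ∃ c > 0, ∀ n : ℕ, ∃ R ∈ S.markovSeq P (n + 1), c * (S.lam⁻¹) ^ n ≤ diam R := by
  have hl : 0 < S.lam := zero_lt_one.trans S.one_lt_lam
  rcases min_choice (lipConst ⇑S.phi) (lipConst ⇑S.phi.symm) with h | h
  · rw [h] at hsc
    exact M.diam_lower_aux (lip_of_lipConst hl.le hsc.symm)
  · rw [h] at hsc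
    have := M.inv.diam_lower_aux (lip_of_lipConst hl.le hsc.symm)
    simp only [inv_markovSeq] at this
    exact this

end SmaleSpace

open Set Metric MeasureTheory Topology
open scoped ENNReal NNReal

namespace SmaleSpace

theorem growth_aux (a : ℕ → ℝ) (c : ℝ) (h0 : ∀ n, 0 ≤ a n) (h1 : ∀ m n, a (m + n) ≤ a m + a n)
    (h2 : ∀ m n, a m + a n ≤ a (m + n) + c) :
    ∃ L : ℝ, ∀ n : ℕ, L * n ≤ a n ∧ a n ≤ L * n + c := by
  have hs : Subadditive a := h1
  have hb : BddBelow (range fun n => a n / n) :=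
    ⟨0, by rintro _ ⟨n, rfl⟩; exact div_nonneg (h0 n) (by positivity)⟩
  have hc : a 0 ≤ c := by linarith [h2 0 0]
  refine ⟨hs.lim, fun n => ?_⟩
  rcases Nat.eq_zero_or_pos n with rfl | hn
  · simpa using ⟨h0 0, hc⟩
  have hn' : (0 : ℝ) < n := by exact_mod_cast hn
  constructor
  · have := hs.lim_le_div hb hn.ne'
    rwa [le_div_iff₀ hn'] at this
  · have h3 : ∀ k : ℕ, (k + 1) * a n - k * c ≤ a ((k + 1) * n) := by
      intro k
      induction k with
      | zero => simp
      | succ k ih =>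
        have := h2 ((k + 1) * n) n
        have e1 : (k + 1 + 1) * n = (k + 1) * n + n := by ring
        rw [e1]
        push_cast at *
        linarith
    have h4 : Filter.Tendsto (fun k : ℕ => a ((k + 1) * n) / (((k + 1) * n : ℕ) : ℝ)) Filter.atTop
        (𝓝 hs.lim) := by
      refine (hs.tendsto_lim hb).comp ?_
      refine Filter.tendsto_atTop_mono (fun k => ?_) Filter.tendsto_id
      simp only [id]; nlinarith
    have h5 : (a n - c) / n ≤ hs.lim := by
      refine ge_of_tendsto' h4 fun k => ?_
      rw [div_le_div_iff₀ hn' (by positivity)]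
      have := h3 k
      have hc0 : 0 ≤ c := (h0 0).trans hc
      push_cast
      have e2 : (a n - c) * ((k + 1) * n) = ((k + 1) * a n - k * c) * n - c * n := by ring
      rw [e2]
      have : 0 ≤ c * n := by positivity
      nlinarith
    rw [div_le_iff₀ hn'] at h5
    linarith

variable {X : Type*} [MetricSpace X] {S : SmaleSpace X} {P : Set (Set X)} {e : ℝ}

variable (S P) in
/-- coding word of length `n` -/
noncomputable def wd (n : ℕ) (x : X) : Fin n → Set X := fun i => col P ((S.phi ^ ((i : ℕ) : ℤ)) x)

variable (S P) in
/-- admissible words -/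
def W (n : ℕ) : Set (Fin n → Set X) := S.wd P n '' S.good P

variable (S P) in
/-- number of admissible words -/
noncomputable def NW (n : ℕ) : ℕ := (S.W P n).ncard

theorem wd_eq_iff {n : ℕ} {x y : X} : S.wd P n x = S.wd P n y ↔
    ∀ i : ℕ, i < n → col P ((S.phi ^ (i : ℤ)) x) = col P ((S.phi ^ (i : ℤ)) y) :=
  ⟨fun h i hi => congrFun h ⟨i, hi⟩, fun h => funext fun i => h i i.2⟩

theorem MS.W_finite (M : S.MS P e) (n : ℕ) : (S.W P n).Finite := by
  have h1 : {g : Fin n → Set X | ∀ i, g i ∈ P}.Finite := Set.Finite.pi' fun _ => M.fin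
  refine h1.subset ?_
  rintro _ ⟨x, hx, rfl⟩ i
  exact (good_col hx _).1

theorem exists_pt [Nonempty X] (S : SmaleSpace X) (P : Set (Set X)) (n : ℕ) :
    ∃ f : (Fin n → Set X) → X, ∀ w ∈ S.W P n, f w ∈ S.good P ∧ S.wd P n (f w) = w := by
  have : ∀ w : Fin n → Set X, ∃ x, w ∈ S.W P n → x ∈ S.good P ∧ S.wd P n x = w := by
    intro w
    by_cases hw : w ∈ S.W P n
    · obtain ⟨x, hx, hxw⟩ := hw
      exact ⟨x, fun _ => ⟨hx, hxw⟩⟩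
    · exact ⟨Classical.arbitrary X, fun h => (hw h).elim⟩
  choose f hf using this
  exact ⟨f, fun w hw => hf w hw⟩

theorem wd_mem {x : X} (hx : x ∈ S.good P) (n : ℕ) : S.wd P n x ∈ S.W P n := ⟨x, hx, rfl⟩

theorem MS.count_upper (M : S.MS P e) (a l b : ℕ)
    (f : (Fin (a + l + b) → Set X) → X)
    (hf : ∀ w ∈ S.W P (a + l + b), f w ∈ S.good P ∧ S.wd P (a + l + b) (f w) = w) (y : X) :
    {w ∈ S.W P (a + l + b) | ∀ i : ℕ, i < l →
      col P ((S.phi ^ ((a + i : ℕ) : ℤ)) (f w)) = col P ((S.phi ^ (i : ℤ)) y)}.ncard ≤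
      S.NW P a * S.NW P b := by
  rw [NW, NW, ← ncard_prod]
  refine ncard_le_ncard_of_injOn (fun w => (S.wd P a (f w),
    S.wd P b ((S.phi ^ ((a + l : ℕ) : ℤ)) (f w)))) ?_ ?_ ((M.W_finite a).prod (M.W_finite b))
  · rintro w ⟨hw, -⟩
    exact ⟨wd_mem (hf w hw).1 a, wd_mem (good_zpow (hf w hw).1 _) b⟩
  · rintro w ⟨hw, hwl⟩ w' ⟨hw', hwl'⟩ heq
    simp only [Prod.mk.injEq] at heq
    obtain ⟨e1, e2⟩ := heq
    rw [wd_eq_iff] at e1 e2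
    rw [← (hf w hw).2, ← (hf w' hw').2, wd_eq_iff]
    intro i hi
    rcases lt_or_ge i a with h1 | h1
    · exact e1 i h1
    rcases lt_or_ge i (a + l) with h2 | h2
    · have k1 := hwl (i - a) (by omega)
      have k2 := hwl' (i - a) (by omega)
      rw [show a + (i - a) = i by omega] at k1 k2
      rw [k1, k2]
    · have k1 := e2 (i - (a + l)) (by omega)
      rw [← zpow_add_apply, ← zpow_add_apply] at k1
      rw [show ((i - (a + l) : ℕ) : ℤ) + ((a + l : ℕ) : ℤ) = i by omega] at k1
      exact k1

theorem MS.NW_submul [Nonempty X] (M : S.MS P e) (m n : ℕ) :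
    S.NW P (m + n) ≤ S.NW P m * S.NW P n := by
  obtain ⟨f, hf⟩ := exists_pt S P (m + 0 + n)
  have h := M.count_upper m 0 n f hf (Classical.arbitrary X)
  have e1 : {w ∈ S.W P (m + 0 + n) | ∀ i : ℕ, i < 0 →
      col P ((S.phi ^ ((m + i : ℕ) : ℤ)) (f w)) =
        col P ((S.phi ^ (i : ℤ)) (Classical.arbitrary X))} = S.W P (m + 0 + n) := by
    ext w; simp
  rw [e1] at h
  exact h

theorem MS.NW_pos [CompactSpace X] [Nonempty X] (M : S.MS P e) (n : ℕ) : 0 < S.NW P n := by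
  obtain ⟨x, hx⟩ := M.dense.nonempty
  exact (ncard_pos (M.W_finite n)).2 ⟨_, wd_mem hx n⟩

variable (S P) in
/-- specification with gap `K` -/
def Spec (K : ℕ) : Prop := 1 ≤ K ∧ ∀ x ∈ S.good P, ∀ y ∈ S.good P, ∀ m n : ℕ, ∃ z ∈ S.good P,
      (∀ i : ℤ, 0 ≤ i → i ≤ m → col P ((S.phi ^ i) z) = col P ((S.phi ^ i) x)) ∧
      (∀ i : ℤ, 0 ≤ i → i ≤ n → col P ((S.phi ^ (m + K + i)) z) = col P ((S.phi ^ i) y))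

theorem MS.NW_supmul [Nonempty X] (M : S.MS P e) {K : ℕ} (hK : S.Spec P K) (m n : ℕ) :
    S.NW P (m + 1) * S.NW P (n + 1) ≤ S.NW P (m + K + n + 1) := by
  obtain ⟨f, hf⟩ := exists_pt S P (m + 1)
  obtain ⟨g, hg⟩ := exists_pt S P (n + 1)
  have hz : ∀ p : (Fin (m + 1) → Set X) × (Fin (n + 1) → Set X), ∃ z,
      p ∈ (S.W P (m + 1)) ×ˢ (S.W P (n + 1)) → z ∈ S.good P ∧
      S.wd P (m + 1) z = p.1 ∧ S.wd P (n + 1) ((S.phi ^ ((m + K : ℕ) : ℤ)) z) = p.2 := by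
    intro p
    by_cases hp : p ∈ (S.W P (m + 1)) ×ˢ (S.W P (n + 1))
    · obtain ⟨z, h1, h2, h3⟩ := hK.2 _ (hf _ hp.1).1 _ (hg _ hp.2).1 m n
      refine ⟨z, fun _ => ⟨h1, ?_, ?_⟩⟩
      · rw [← (hf _ hp.1).2, wd_eq_iff]
        exact fun i hi => h2 i (by omega) (by omega)
      · rw [← (hg _ hp.2).2, wd_eq_iff]
        intro i hi
        rw [← h3 i (by omega) (by omega), ← zpow_add_apply]
        congr 3
        push_cast; ring
    · exact ⟨Classical.arbitrary X, fun h => (hp h).elim⟩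
  choose z hz using hz
  rw [NW, NW, ← ncard_prod]
  refine ncard_le_ncard_of_injOn (fun p => S.wd P _ (z p)) (fun p hp => wd_mem (hz p hp).1 _) ?_
    (M.W_finite _)
  intro p hp q hq h
  simp only [wd_eq_iff] at h
  obtain ⟨-, a1, a2⟩ := hz p hp
  obtain ⟨-, b1, b2⟩ := hz q hq
  refine Prod.ext ?_ ?_
  · rw [← a1, ← b1, wd_eq_iff]
    exact fun i hi => h i (by omega)
  · rw [← a2, ← b2, wd_eq_iff]
    intro i hi
    rw [← zpow_add_apply, ← zpow_add_apply]
    have := h (i + (m + K)) (by omega)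
    push_cast at this ⊢
    exact this

theorem MS.count_lower [Nonempty X] (M : S.MS P e) {K : ℕ} (hK : S.Spec P K) (a l b : ℕ)
    (f : (Fin ((a + K) + (l + 1) + (b + K)) → Set X) → X)
    (hf : ∀ w ∈ S.W P ((a + K) + (l + 1) + (b + K)), f w ∈ S.good P ∧
      S.wd P ((a + K) + (l + 1) + (b + K)) (f w) = w) (y : X) (hy : y ∈ S.good P) :
    S.NW P (a + 1) * S.NW P (b + 1) ≤
    {w ∈ S.W P ((a + K) + (l + 1) + (b + K)) | ∀ i : ℕ, i < l + 1 →
      col P ((S.phi ^ ((a + K + i : ℕ) : ℤ)) (f w)) = col P ((S.phi ^ (i : ℤ)) y)}.ncard := by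
  obtain ⟨g1, hg1⟩ := exists_pt S P (a + 1)
  obtain ⟨g2, hg2⟩ := exists_pt S P (b + 1)
  have hz : ∀ p : (Fin (a + 1) → Set X) × (Fin (b + 1) → Set X), ∃ z,
      p ∈ (S.W P (a + 1)) ×ˢ (S.W P (b + 1)) → z ∈ S.good P ∧
      S.wd P (a + 1) z = p.1 ∧ S.wd P (b + 1) ((S.phi ^ ((a + K + l + K : ℕ) : ℤ)) z) = p.2 ∧
      ∀ i : ℕ, i < l + 1 →
        col P ((S.phi ^ ((a + K + i : ℕ) : ℤ)) z) = col P ((S.phi ^ (i : ℤ)) y) := by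
    intro p
    by_cases hp : p ∈ (S.W P (a + 1)) ×ˢ (S.W P (b + 1))
    · obtain ⟨z1, h1, h2, h3⟩ := hK.2 _ (hg1 _ hp.1).1 _ hy a l
      obtain ⟨z, k1, k2, k3⟩ := hK.2 _ h1 _ (hg2 _ hp.2).1 (a + K + l) b
      refine ⟨z, fun _ => ⟨k1, ?_, ?_, ?_⟩⟩
      · rw [← (hg1 _ hp.1).2, wd_eq_iff]
        intro i hi
        rw [k2 i (by omega) (by push_cast; omega), h2 i (by omega) (by omega)]
      · rw [← (hg2 _ hp.2).2, wd_eq_iff]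
        intro i hi
        rw [← k3 i (by omega) (by omega), ← zpow_add_apply]
        congr 3
        push_cast; ring
      · intro i hi
        rw [k2 _ (by omega) (by push_cast; omega), ← h3 i (by omega) (by omega)]
        congr 3
    · exact ⟨Classical.arbitrary X, fun h => (hp h).elim⟩
  choose z hz using hz
  rw [NW, NW, ← ncard_prod]
  refine ncard_le_ncard_of_injOn (fun p => S.wd P _ (z p)) ?_ ?_
    ((M.W_finite _).subset fun w hw => hw.1)
  · intro p hp
    have hw := wd_mem (hz p hp).1 ((a + K) + (l + 1) + (b + K))
    refine ⟨hw, fun i hi => ?_⟩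
    rw [← (hz p hp).2.2.2 i hi]
    exact (wd_eq_iff.1 (hf _ hw).2) _ (by omega)
  intro p hp q hq h
  simp only [wd_eq_iff] at h
  obtain ⟨-, a1, a2, -⟩ := hz p hp
  obtain ⟨-, b1, b2, -⟩ := hz q hq
  refine Prod.ext ?_ ?_
  · rw [← a1, ← b1, wd_eq_iff]
    exact fun i hi => h i (by omega)
  · rw [← a2, ← b2, wd_eq_iff]
    intro i hi
    rw [← zpow_add_apply, ← zpow_add_apply]
    have := h (i + (a + K + l + K)) (by omega)
    push_cast at this ⊢
    exact this

theorem MS.growth [CompactSpace X] [Nonempty X] (M : S.MS P e) {K : ℕ} (hK : S.Spec P K) :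
    ∃ L C : ℝ, 1 ≤ C ∧ ∀ n : ℕ, Real.exp (L * n) ≤ S.NW P n ∧
      (S.NW P n : ℝ) ≤ C * Real.exp (L * n) := by
  have hpos : ∀ n, (0 : ℝ) < S.NW P n := fun n => by exact_mod_cast M.NW_pos n
  have hge : ∀ n, (1 : ℝ) ≤ S.NW P n := fun n => by exact_mod_cast M.NW_pos n
  have hN0 : S.NW P 0 = 1 := by
    refine le_antisymm ?_ (M.NW_pos 0)
    rw [NW, ncard_le_one (M.W_finite 0)]
    intro a _ b _; exact Subsingleton.elim _ _
  have hsup : ∀ m n, S.NW P m * S.NW P n ≤ S.NW P (m + n) * S.NW P (K - 1) := by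
    intro m n
    rcases m with _ | m
    · rw [hN0, one_mul, zero_add]; exact Nat.le_mul_of_pos_right _ (M.NW_pos _)
    rcases n with _ | n
    · rw [hN0, mul_one, add_zero]; exact Nat.le_mul_of_pos_right _ (M.NW_pos _)
    refine (M.NW_supmul hK m n).trans ?_
    have := M.NW_submul (m + 1 + (n + 1)) (K - 1)
    have h1 := hK.1
    rwa [show m + 1 + (n + 1) + (K - 1) = m + K + n + 1 by omega] at this
  obtain ⟨L, hL⟩ := growth_aux (fun n => Real.log (S.NW P n)) (Real.log (S.NW P (K - 1)))
    (fun n => Real.log_nonneg (hge n)) (fun m n => by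
      rw [← Real.log_mul (hpos m).ne' (hpos n).ne']
      exact Real.log_le_log (hpos _) (by exact_mod_cast M.NW_submul m n)) (fun m n => by
      rw [← Real.log_mul (hpos m).ne' (hpos n).ne', ← Real.log_mul (hpos _).ne' (hpos _).ne']
      exact Real.log_le_log (mul_pos (hpos _) (hpos _)) (by exact_mod_cast hsup m n))
  refine ⟨L, S.NW P (K - 1), hge _, fun n => ⟨?_, ?_⟩⟩
  · rw [← Real.le_log_iff_exp_le (hpos n)]
    exact (hL n).1
  · rw [← Real.log_le_log_iff (hpos n) (mul_pos (hpos _) (Real.exp_pos _)),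
      Real.log_mul (hpos _).ne' (Real.exp_pos _).ne', Real.log_exp]
    linarith [(hL n).2]

theorem MS.rset_of_wd (M : S.MS P e) {n : ℕ} {x y : X} (hx : x ∈ S.good P) (hy : y ∈ S.good P)
    (h : S.wd P (2 * n + 1) ((S.phi ^ (-(n : ℤ))) x) = S.wd P (2 * n + 1) ((S.phi ^ (-(n : ℤ))) y)) :
    S.rset P n x = S.rset P n y := by
  rw [wd_eq_iff] at h
  refine iInter₂_congr fun i hi => ?_
  rw [Finset.mem_Icc] at hi
  have := h (i + n).toNat (by omega)
  rw [← zpow_add_apply, ← zpow_add_apply, show ((i + n).toNat : ℤ) + -n = i by omega] at this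
  rw [this]

theorem MS.L_pos [CompactSpace X] [Infinite X] (M : S.MS P e) {L C : ℝ}
    (h : ∀ n : ℕ, (S.NW P n : ℝ) ≤ C * Real.exp (L * n)) (hC : 0 ≤ C) : 0 < L := by
  by_contra! hL
  obtain ⟨m, hm⟩ := exists_nat_ge C
  have hN : ∀ n, S.NW P n ≤ m := by
    intro n
    have h1 : Real.exp (L * n) ≤ 1 :=
      Real.exp_le_one_iff.2 (mul_nonpos_of_nonpos_of_nonneg hL (by positivity))
    have : (S.NW P n : ℝ) ≤ m := (h n).trans (by nlinarith)
    exact_mod_cast this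
  have hfin : (S.good P).Finite := by
    refine finite_of_codes (β := Set X) _ m fun δ hδ => ?_
    obtain ⟨n, hn⟩ := lam_pow_small S (2 * e) hδ
    refine ⟨S.rset P n, ?_, ?_, ?_⟩
    · refine (M.markov_finite (n + 1)).subset ?_
      rintro _ ⟨x, hx, rfl⟩; exact rset_mem hx
    · refine le_trans ?_ (hN (2 * n + 1))
      have hch : ∀ R : Set X, ∃ x, R ∈ S.rset P n '' S.good P → x ∈ S.good P ∧ S.rset P n x = R := by
        intro R
        by_cases hR : R ∈ S.rset P n '' S.good P
        · obtain ⟨x, hx, hxR⟩ := hR; exact ⟨x, fun _ => ⟨hx, hxR⟩⟩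
        · exact ⟨Classical.arbitrary X, fun h => (hR h).elim⟩
      choose g hg using hch
      refine ncard_le_ncard_of_injOn
        (fun R => S.wd P (2 * n + 1) ((S.phi ^ (-(n : ℤ))) (g R))) ?_ ?_ (M.W_finite _)
      · intro R hR; exact wd_mem (good_zpow (hg R hR).1 _) _
      · intro R hR R' hR' hh
        rw [← (hg R hR).2, ← (hg R' hR').2]
        exact M.rset_of_wd (hg R hR).1 (hg R' hR').1 hh
    · intro x hx y hy hxy
      exact (M.rset_dist hx (self_mem_rset hx) (hxy ▸ self_mem_rset hy)).trans_lt hn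
  have := hfin.isClosed.closure_eq
  rw [M.dense.closure_eq] at this
  exact Set.infinite_univ (this ▸ hfin)

end SmaleSpace

open Set Metric MeasureTheory Topology
open scoped ENNReal NNReal

namespace SmaleSpace

variable {X : Type*} [MetricSpace X] {S : SmaleSpace X} {P : Set (Set X)} {e : ℝ}

theorem iterate_eq_zpow (S : SmaleSpace X) (n : ℕ) (x : X) :
    (⇑S.phi)^[n] x = (S.phi ^ (n : ℤ)) x := by
  rw [zpow_natCast, Equiv.Perm.coe_pow]

theorem MS.upper_cover [CompactSpace X] [Nonempty X] (M : S.MS P e) {δ : ℝ} (hδ : 0 < δ) :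
    ∃ m : ℕ, ∀ n, ∃ s : Finset X,
      Dynamics.IsDynCoverOf ⇑S.phi univ {p : X × X | dist p.1 p.2 < δ} n s ∧
        s.card ≤ S.NW P (n + 2 * m) := by
  classical
  obtain ⟨m, hm⟩ := lam_pow_small S (2 * e) (half_pos hδ)
  refine ⟨m, fun n => ?_⟩
  obtain ⟨f, hf⟩ := exists_pt S P (n + 2 * m)
  refine ⟨(M.W_finite (n + 2 * m)).toFinset.image fun w => (S.phi ^ (m : ℤ)) (f w), ?_, ?_⟩
  · intro z _
    have hO : {x | ∀ k ∈ Finset.range n,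
        dist ((S.phi ^ (k : ℤ)) z) ((S.phi ^ (k : ℤ)) x) < δ / 2} ∈ 𝓝 z := by
      rw [Filter.eventually_mem_set.symm]
      simp only [mem_ofPred_eq]
      rw [Filter.eventually_all_finset]
      intro k _
      have hc : Continuous fun x => dist ((S.phi ^ (k : ℤ)) z) ((S.phi ^ (k : ℤ)) x) :=
        continuous_const.dist (S.zpow_cont k)
      exact hc.continuousAt.eventually (gt_mem_nhds (by simpa using half_pos hδ))
    obtain ⟨x, hxg, hx⟩ := M.dense.inter_nhds_nonempty hO
    set w := S.wd P (n + 2 * m) ((S.phi ^ (-(m : ℤ))) x) with hw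
    have hwW : w ∈ S.W P (n + 2 * m) := wd_mem (good_zpow hxg _) _
    refine ⟨(S.phi ^ (m : ℤ)) (f w), by simpa using ⟨w, hwW, rfl⟩, ?_⟩
    rw [Dynamics.mem_dynEntourage]
    intro k hk
    simp only [mem_ofPred_eq]
    rw [iterate_eq_zpow, iterate_eq_zpow]
    have h1 := hx k (Finset.mem_range.2 hk)
    have h2 : dist ((S.phi ^ (k : ℤ)) x) ((S.phi ^ (k : ℤ)) ((S.phi ^ (m : ℤ)) (f w))) ≤
        2 * e * (S.lam⁻¹) ^ m := by
      have hg := good_zpow hxg (k : ℤ)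
      refine M.rset_dist hg (self_mem_rset hg) ?_
      rw [mem_rset]
      intro i hi1 hi2
      have h3 := (wd_eq_iff.1 ((hf w hwW).2.trans hw)) (i + k + m).toNat (by omega)
      rw [← zpow_add_apply] at h3
      have e1 : ((i + k + m).toNat : ℤ) + -(m : ℤ) = i + k := by omega
      have e2 : ((i + k + m).toNat : ℤ) = i + (k + m) := by omega
      rw [e1, e2] at h3
      rw [← zpow_add_apply, ← zpow_add_apply, ← zpow_add_apply, ← h3]
      rw [show i + (k + m : ℤ) = i + k + m by ring]
      exact interior_subset (good_col (hf w hwW).1 _).2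
    linarith [dist_triangle ((S.phi ^ (k : ℤ)) z) ((S.phi ^ (k : ℤ)) x)
      ((S.phi ^ (k : ℤ)) ((S.phi ^ (m : ℤ)) (f w)))]
  · refine Finset.card_image_le.trans ?_
    rw [NW, ncard_eq_toFinset_card _ (M.W_finite _)]

theorem MS.lower_cover [CompactSpace X] [Nonempty X] (M : S.MS P e) (n : ℕ) (s : Finset X)
    (hs : Dynamics.IsDynCoverOf ⇑S.phi univ {p : X × X | dist p.1 p.2 < S.eps / 4} (n + 1) s) :
    S.NW P (n + 1) ≤ P.ncard ^ 2 * s.card := by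
  obtain ⟨f, hf⟩ := exists_pt S P (n + 1)
  choose g hg1 hg2 using fun x => hs (mem_univ x)
  have hinj : S.NW P (n + 1) ≤ ((P ×ˢ P) ×ˢ (s : Set X)).ncard := by
    refine ncard_le_ncard_of_injOn (fun w => ((col P (f w), col P ((S.phi ^ (n : ℤ)) (f w))),
      g (f w))) ?_ ?_ ((M.fin.prod M.fin).prod s.finite_toSet)
    · intro w hw
      exact ⟨⟨(good_col0 (hf w hw).1).1, (good_col (hf w hw).1 _).1⟩, hg1 _⟩
    · intro w hw w' hw' heq
      simp only [Prod.mk.injEq] at heq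
      obtain ⟨⟨h1, h2⟩, h3⟩ := heq
      rw [← (hf w hw).2, ← (hf w' hw').2, wd_eq_iff]
      intro i hi
      refine M.bowen (hf w hw).1 (hf w' hw').1 n h1 h2 ?_ i (by omega)
      intro k hk
      have k1 := Dynamics.mem_dynEntourage.1 (hg2 (f w)) k (by omega)
      have k2 := Dynamics.mem_dynEntourage.1 (hg2 (f w')) k (by omega)
      simp only [mem_ofPred_eq] at k1 k2
      rw [iterate_eq_zpow, iterate_eq_zpow] at k1 k2
      rw [← h3] at k2
      linarith [dist_triangle_right ((S.phi ^ (k : ℤ)) (f w)) ((S.phi ^ (k : ℤ)) (f w'))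
        ((S.phi ^ (k : ℤ)) (g (f w)))]
  rw [ncard_prod, ncard_prod, ncard_coe_finset] at hinj
  rwa [pow_two]

theorem MS.entropy [CompactSpace X] [Nonempty X] (M : S.MS P e) {L C : ℝ} (hC : 1 ≤ C)
    (hg : ∀ n : ℕ, Real.exp (L * n) ≤ S.NW P n ∧ (S.NW P n : ℝ) ≤ C * Real.exp (L * n)) :
    Dynamics.coverEntropy ⇑S.phi univ = (L : EReal) := by
  have hexp : ∀ n : ℕ, EReal.exp ((L : EReal) * n) = ENNReal.ofReal (Real.exp (L * n)) := by
    intro n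
    rw [← EReal.exp_coe]; push_cast; rfl
  refine le_antisymm ?_ ?_
  · rw [Dynamics.coverEntropy_eq_iSup_basis Metric.uniformity_basis_dist]
    refine iSup₂_le fun δ hδ => ?_
    obtain ⟨m, hm⟩ := M.upper_cover hδ
    rw [← ExpGrowth.expGrowthSup_exp (a := (L : EReal))]
    refine ExpGrowth.expGrowthSup_le_of_eventually_le
      (b := ENNReal.ofReal (C * Real.exp (L * (2 * m)))) ENNReal.ofReal_ne_top ?_
    refine Filter.Eventually.of_forall fun n => ?_
    obtain ⟨s, hs, hsc⟩ := hm n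
    have h1 : (Dynamics.coverMincard ⇑S.phi univ {p : X × X | dist p.1 p.2 < δ} n : ℝ≥0∞) ≤
        ((s.card : ℕ∞) : ℝ≥0∞) := by exact_mod_cast hs.coverMincard_le_card
    refine h1.trans ?_
    rw [hexp, ← ENNReal.ofReal_mul (by positivity)]
    have h2 : ((s.card : ℕ∞) : ℝ≥0∞) = ENNReal.ofReal (s.card : ℝ) := by simp
    rw [h2]
    refine ENNReal.ofReal_le_ofReal ?_
    refine (Nat.cast_le.2 hsc).trans ((hg _).2.trans ?_)
    rw [mul_assoc, ← Real.exp_add]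
    push_cast
    apply le_of_eq; ring_nf
  · refine le_trans ?_ (Dynamics.coverEntropyEntourage_le_coverEntropy (U := {p : X × X | dist p.1 p.2 < S.eps / 4}) _ _
      (Metric.dist_mem_uniformity (by linarith [S.eps_pos])))
    rw [← ExpGrowth.expGrowthSup_exp (a := (L : EReal))]
    refine ExpGrowth.expGrowthSup_le_of_eventually_le
      (b := ((P.ncard ^ 2 : ℕ) : ℝ≥0∞)) (ENNReal.natCast_ne_top _) ?_
    filter_upwards [Filter.eventually_ge_atTop 1] with n hn
    obtain ⟨n, rfl⟩ : ∃ k, n = k + 1 := ⟨n - 1, by omega⟩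
    rw [hexp]
    have hfin : Dynamics.coverMincard ⇑S.phi univ {p : X × X | dist p.1 p.2 < S.eps / 4} (n + 1) < ⊤ :=
      Dynamics.coverMincard_finite_of_isCompact_uniformContinuous isCompact_univ
        (CompactSpace.uniformContinuous_of_continuous S.phi_cont) (Metric.dist_mem_uniformity (by linarith [S.eps_pos])) _
    rw [Dynamics.coverMincard_finite_iff] at hfin
    obtain ⟨s, hs, hsc⟩ := hfin
    rw [← hsc]
    have h1 := M.lower_cover n s hs
    have h2 : Real.exp (L * ((n + 1 : ℕ) : ℝ)) ≤ ((P.ncard ^ 2 * s.card : ℕ) : ℝ) :=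
      (hg (n + 1)).1.trans (Nat.cast_le.2 h1)
    refine (ENNReal.ofReal_le_ofReal h2).trans ?_
    rw [ENNReal.ofReal_natCast]
    push_cast; simp

end SmaleSpace

open Set Metric MeasureTheory Topology
open scoped ENNReal NNReal

namespace SmaleSpace

section emp
variable {X : Type*} [MeasurableSpace X] {ι : Type*}

/-- averaged empirical measure -/
noncomputable def emp (A : Finset ι) (n : ℕ) (p : ℕ → ι → X) : Measure X :=
  ((n * A.card : ℕ) : ℝ≥0∞)⁻¹ • ∑ j ∈ Finset.range n, ∑ w ∈ A, Measure.dirac (p j w)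

open Classical in
theorem emp_apply (A : Finset ι) (n : ℕ) (p : ℕ → ι → X) {E : Set X} (hE : MeasurableSet E) :
    emp A n p E = ((n * A.card : ℕ) : ℝ≥0∞)⁻¹ *
      ((∑ j ∈ Finset.range n, (A.filter fun w => p j w ∈ E).card : ℕ) : ℝ≥0∞) := by
  have h1 : ∀ j, ∑ w ∈ A, (Measure.dirac (p j w)) E =
      (((A.filter fun w => p j w ∈ E).card : ℕ) : ℝ≥0∞) := by
    intro j
    rw [Finset.card_filter]
    push_cast
    refine Finset.sum_congr rfl fun w _ => ?_
    rw [Measure.dirac_apply' _ hE]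
    by_cases h : p j w ∈ E <;> simp [h]
  simp only [emp, Measure.smul_apply, Measure.coe_finsetSum, Finset.sum_apply, smul_eq_mul, h1]
  push_cast
  rfl

theorem emp_prob (A : Finset ι) (hA : A.Nonempty) (n : ℕ) (hn : 0 < n) (p : ℕ → ι → X) :
    IsProbabilityMeasure (emp A n p) := by
  classical
  constructor
  rw [emp_apply A n p MeasurableSet.univ]
  simp only [mem_univ, Finset.filter_true, Finset.sum_const, Finset.card_range, smul_eq_mul]
  refine ENNReal.inv_mul_cancel ?_ (ENNReal.natCast_ne_top _)
  have := hA.card_pos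
  exact_mod_cast (Nat.mul_pos hn this).ne'

open Classical in
theorem emp_ge (A : Finset ι) (hA : A.Nonempty) (n : ℕ) (hn : 0 < n) (p : ℕ → ι → X) {E : Set X}
    (hE : MeasurableSet E) {t : ℝ}
    (h : ∀ j < n, t * A.card ≤ ((A.filter fun w => p j w ∈ E).card : ℝ)) :
    ENNReal.ofReal t ≤ emp A n p E := by
  rw [emp_apply A n p hE, mul_comm, ← div_eq_mul_inv]
  have hc := hA.card_pos
  have hc' : 0 < n * A.card := Nat.mul_pos hn hc
  rw [ENNReal.le_div_iff_mul_le (Or.inl (by exact_mod_cast hc'.ne')) (Or.inl (ENNReal.natCast_ne_top _))]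
  rw [← ENNReal.ofReal_natCast, ← ENNReal.ofReal_natCast, ← ENNReal.ofReal_mul' (by positivity)]
  refine ENNReal.ofReal_le_ofReal ?_
  push_cast
  have := Finset.sum_le_sum (fun j hj => h j (Finset.mem_range.1 hj))
  rw [Finset.sum_const, Finset.card_range, nsmul_eq_mul] at this
  linarith

open Classical in
theorem emp_le (A : Finset ι) (hA : A.Nonempty) (n : ℕ) (hn : 0 < n) (p : ℕ → ι → X) {E : Set X}
    (hE : MeasurableSet E) {t : ℝ}
    (h : ∀ j < n, ((A.filter fun w => p j w ∈ E).card : ℝ) ≤ t * A.card) :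
    emp A n p E ≤ ENNReal.ofReal t := by
  rw [emp_apply A n p hE, mul_comm, ← div_eq_mul_inv]
  have hc := hA.card_pos
  have hc' : 0 < n * A.card := Nat.mul_pos hn hc
  rw [ENNReal.div_le_iff (by exact_mod_cast hc'.ne') (ENNReal.natCast_ne_top _)]
  rw [← ENNReal.ofReal_natCast, ← ENNReal.ofReal_natCast, ← ENNReal.ofReal_mul' (by positivity)]
  refine ENNReal.ofReal_le_ofReal ?_
  push_cast
  have := Finset.sum_le_sum (fun j hj => h j (Finset.mem_range.1 hj))
  rw [Finset.sum_const, Finset.card_range, nsmul_eq_mul] at this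
  linarith

theorem emp_integral [TopologicalSpace X] [OpensMeasurableSpace X] (A : Finset ι) (n : ℕ)
    (p : ℕ → ι → X) {f : X → ℝ} (hf : Continuous f) :
    ∫ x, f x ∂(emp A n p) = ((n * A.card : ℕ) : ℝ)⁻¹ *
      ∑ j ∈ Finset.range n, ∑ w ∈ A, f (p j w) := by
  have hm : StronglyMeasurable f := hf.measurable.stronglyMeasurable
  have hi : ∀ x, Integrable f (Measure.dirac x) := fun x =>
    integrable_dirac' hm (by simp)
  rw [emp, integral_smul_measure, integral_finsetSum_measure]
  · rw [smul_eq_mul]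
    congr 1
    · simp
    refine Finset.sum_congr rfl fun j _ => ?_
    rw [integral_finsetSum_measure fun w _ => hi _]
    exact Finset.sum_congr rfl fun w _ => integral_dirac' _ _ hm
  · intro j _
    exact integrable_finsetSum_measure.2 fun w _ => hi _

end emp

variable {X : Type*} [MetricSpace X] {S : SmaleSpace X} {P : Set (Set X)} {e : ℝ}

theorem MS.count_upper' (M : S.MS P e) (a l b N : ℕ) (hN : a + l + b = N)
    (f : (Fin N → Set X) → X)
    (hf : ∀ w ∈ S.W P N, f w ∈ S.good P ∧ S.wd P N (f w) = w) (y : X) :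
    {w ∈ S.W P N | ∀ i : ℕ, i < l →
      col P ((S.phi ^ ((a + i : ℕ) : ℤ)) (f w)) = col P ((S.phi ^ (i : ℤ)) y)}.ncard ≤
      S.NW P a * S.NW P b := by
  subst hN
  exact M.count_upper a l b f hf y

theorem MS.count_lower' [Nonempty X] (M : S.MS P e) {K : ℕ} (hK : S.Spec P K) (a l b N : ℕ)
    (hN : (a + K) + (l + 1) + (b + K) = N) (f : (Fin N → Set X) → X)
    (hf : ∀ w ∈ S.W P N, f w ∈ S.good P ∧ S.wd P N (f w) = w) (y : X) (hy : y ∈ S.good P) :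
    S.NW P (a + 1) * S.NW P (b + 1) ≤
    {w ∈ S.W P N | ∀ i : ℕ, i < l + 1 →
      col P ((S.phi ^ ((a + K + i : ℕ) : ℤ)) (f w)) = col P ((S.phi ^ (i : ℤ)) y)}.ncard := by
  subst hN
  exact M.count_lower hK a l b f hf y hy

/-- the averaged measures -/
theorem MS.approx [CompactSpace X] [Nonempty X] [MeasurableSpace X] [BorelSpace X] (M : S.MS P e)
    {K : ℕ} (hK : S.Spec P K) {L C : ℝ} (hC : 1 ≤ C)
    (hg : ∀ n : ℕ, Real.exp (L * n) ≤ S.NW P n ∧ (S.NW P n : ℝ) ≤ C * Real.exp (L * n))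
    (n : ℕ) (hn : 0 < n) :
    ∃ μ : ProbabilityMeasure X,
      (∀ f : BoundedContinuousFunction X ℝ, |∫ x, f (S.phi x) ∂(μ : Measure X) - ∫ x, f x ∂(μ : Measure X)| ≤ 2 * ‖f‖ / n) ∧
      (∀ m x, m + K ≤ n → x ∈ S.good P → ENNReal.ofReal (C⁻¹ * Real.exp (L * (1 - 2 * K)) *
        Real.exp (-(2 * L * m))) ≤ (μ : Measure X) (S.rset P m x)) ∧
      (∀ m U, m + K ≤ n → IsOpen U → (μ : Measure X) U ≤
        ENNReal.ofReal ((nbr (S.markovSeq P (m + 1)) U).ncard * (C ^ 2 * Real.exp (-L) *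
          Real.exp (-(2 * L * m))))) := by
  classical
  obtain ⟨f, hf⟩ := exists_pt S P (3 * n)
  set A := (M.W_finite (3 * n)).toFinset with hA
  have hAc : A.card = S.NW P (3 * n) := by rw [NW, ncard_eq_toFinset_card _ (M.W_finite _)]
  have hAne : A.Nonempty := by rw [← Finset.card_pos, hAc]; exact M.NW_pos _
  have hK1 := hK.1
  set p : ℕ → (Fin (3 * n) → Set X) → X := fun j w => (S.phi ^ ((n + j : ℕ) : ℤ)) (f w) with hp
  refine ⟨⟨emp A n p, emp_prob A hAne n hn p⟩, ?_, ?_, ?_⟩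
  · intro g
    simp only [ProbabilityMeasure.coe_mk]
    rw [emp_integral A n p g.continuous, emp_integral A n p (f := fun x => g (S.phi x)) (g.continuous.comp S.phi_cont),
      ← mul_sub, ← Finset.sum_sub_distrib]
    have hps : ∀ j w, S.phi (p j w) = p (j + 1) w := by
      intro j w
      simp only [hp]
      rw [← zpow_succ_apply]
      congr 2
    simp only [hps]
    rw [Finset.sum_range_sub (fun j => ∑ w ∈ A, g (p j w)), ← Finset.sum_sub_distrib, abs_mul]
    have h1 : |∑ w ∈ A, (g (p n w) - g (p 0 w))| ≤ A.card * (2 * ‖g‖) := by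
      refine (Finset.abs_sum_le_sum_abs _ _).trans ?_
      refine (Finset.sum_le_card_nsmul _ _ (2 * ‖g‖) fun w _ => ?_).trans_eq (nsmul_eq_mul _ _)
      have h2 := g.norm_coe_le_norm (p n w)
      have h3 := g.norm_coe_le_norm (p 0 w)
      rw [Real.norm_eq_abs] at h2 h3
      exact (abs_sub _ _).trans (by linarith)
    have hcpos : (0 : ℝ) < A.card := by exact_mod_cast hAne.card_pos
    have hnpos : (0 : ℝ) < n := by exact_mod_cast hn
    rw [abs_of_nonneg (by positivity)]
    refine (mul_le_mul_of_nonneg_left h1 (by positivity)).trans_eq ?_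
    push_cast
    field_simp
  · intro m x hm hx
    simp only [ProbabilityMeasure.coe_mk]
    refine emp_ge A hAne n hn p (M.rset_closed hx).measurableSet fun j hj => ?_
    obtain ⟨a, ha⟩ : ∃ a, n + j = a + K + m := ⟨n + j - K - m, by omega⟩
    obtain ⟨b, hb⟩ : ∃ b, (a + K) + (2 * m + 1) + (b + K) = 3 * n :=
      ⟨3 * n - ((a + K) + (2 * m + 1)) - K, by omega⟩
    have hcl := M.count_lower' hK a (2 * m) b (3 * n) hb f hf _ (good_zpow hx (-(m : ℤ)))
    have hsub : {w ∈ S.W P (3 * n) | ∀ i : ℕ, i < 2 * m + 1 →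
        col P ((S.phi ^ ((a + K + i : ℕ) : ℤ)) (f w)) =
          col P ((S.phi ^ (i : ℤ)) ((S.phi ^ (-(m : ℤ))) x))} ⊆
        ((A.filter fun w => p j w ∈ S.rset P m x : Finset _) : Set (Fin (3 * n) → Set X)) := by
      rintro w ⟨hw, hw2⟩
      rw [Finset.mem_coe, Finset.mem_filter]
      refine ⟨by simpa [hA] using hw, mem_rset.2 fun i hi1 hi2 => ?_⟩
      have h1 := hw2 (i + m).toNat (by omega)
      rw [← zpow_add_apply, show ((i + m).toNat : ℤ) + -(m : ℤ) = i by omega] at h1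
      rw [← h1, hp]
      simp only
      rw [← zpow_add_apply, show (i + ((n + j : ℕ) : ℤ)) = ((a + K + (i + m).toNat : ℕ) : ℤ) by
        rw [ha]; push_cast; omega]
      exact interior_subset (good_col (hf w hw).1 _).2
    have hle := hcl.trans (ncard_le_ncard hsub (Finset.finite_toSet _))
    rw [ncard_coe_finset] at hle
    refine le_trans ?_ (Nat.cast_le.2 hle)
    rw [hAc]
    push_cast
    have h1 := (hg (a + 1)).1
    have h2 := (hg (b + 1)).1
    have h3 := (hg (3 * n)).2
    have hC0 : (0 : ℝ) < C := by linarith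
    calc C⁻¹ * Real.exp (L * (1 - 2 * K)) * Real.exp (-(2 * L * m)) * (S.NW P (3 * n) : ℝ)
        ≤ C⁻¹ * Real.exp (L * (1 - 2 * K)) * Real.exp (-(2 * L * m)) *
          (C * Real.exp (L * ((3 * n : ℕ) : ℝ))) := by gcongr
      _ = Real.exp (L * (1 - 2 * K)) * Real.exp (-(2 * L * m)) * Real.exp (L * ((3 * n : ℕ) : ℝ)) := by
          field_simp
      _ = Real.exp (L * ((a + 1 : ℕ) : ℝ)) * Real.exp (L * ((b + 1 : ℕ) : ℝ)) := by
          rw [← Real.exp_add, ← Real.exp_add, ← Real.exp_add, ← hb]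
          congr 1
          push_cast
          ring
      _ ≤ _ := by gcongr
  · intro m U hm hU
    simp only [ProbabilityMeasure.coe_mk]
    refine emp_le A hAne n hn p hU.measurableSet fun j hj => ?_
    obtain ⟨a, ha⟩ : ∃ a, n + j = a + m := ⟨n + j - m, by omega⟩
    obtain ⟨b, hb⟩ : ∃ b, a + (2 * m + 1) + b = 3 * n :=
      ⟨3 * n - (a + (2 * m + 1)), by omega⟩
    have hfin : (nbr (S.markovSeq P (m + 1)) U).Finite :=
      (M.markov_finite (m + 1)).subset fun R hR => hR.1
    have hpg : ∀ w ∈ S.W P (3 * n), p j w ∈ S.good P := fun w hw => good_zpow (hf w hw).1 _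
    have hcard : (A.filter fun w => p j w ∈ U).card ≤
        (S.NW P a * S.NW P b) * hfin.toFinset.card := by
      refine Finset.card_le_mul_card_image_of_maps_to (f := fun w => S.rset P m (p j w)) ?_ _ ?_
      · intro w hw
        rw [Finset.mem_filter] at hw
        have hwW : w ∈ S.W P (3 * n) := by simpa [hA] using hw.1
        rw [Finite.mem_toFinset]
        exact ⟨rset_mem (hpg w hwW), p j w, self_mem_rset (hpg w hwW), hw.2⟩
      · intro R hR
        rw [Finite.mem_toFinset] at hR
        obtain ⟨x, hx, hRx⟩ := M.markov_rset hR.1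
        refine le_trans ?_ (M.count_upper' a (2 * m + 1) b (3 * n) hb f hf ((S.phi ^ (-(m : ℤ))) x))
        rw [← ncard_coe_finset]
        refine ncard_le_ncard ?_ ((M.W_finite _).subset fun w hw => hw.1)
        intro w hw
        rw [Finset.mem_coe, Finset.mem_filter, Finset.mem_filter] at hw
        have hwW : w ∈ S.W P (3 * n) := by simpa [hA] using hw.1.1
        refine ⟨hwW, fun i hi => ?_⟩
        have hmem : p j w ∈ S.rset P m x := by
          rw [← hRx, ← hw.2]; exact self_mem_rset (hpg w hwW)
        have := M.col_of_mem_rset hx (hpg w hwW) hmem ((i : ℤ) - m) (by omega) (by omega)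
        rw [← zpow_add_apply, ← sub_eq_add_neg, ← this]
        simp only [hp]
        rw [← zpow_add_apply]
        congr 3
        rw [ha]; push_cast; ring
    rw [← ncard_eq_toFinset_card _ hfin] at hcard
    have hcard' : ((A.filter fun w => p j w ∈ U).card : ℝ) ≤
      ((S.NW P a : ℝ) * S.NW P b) * (nbr (S.markovSeq P (m + 1)) U).ncard := by exact_mod_cast hcard
    refine hcard'.trans ?_
    rw [hAc]
    have h1 := (hg a).2
    have h2 := (hg b).2
    have h3 := (hg (3 * n)).1
    have hC0 : (0 : ℝ) < C := by linarith
    calc ((S.NW P a : ℝ) * S.NW P b) * (nbr (S.markovSeq P (m + 1)) U).ncard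
        ≤ ((C * Real.exp (L * a)) * (C * Real.exp (L * b))) *
            (nbr (S.markovSeq P (m + 1)) U).ncard := by gcongr
      _ = C ^ 2 * (Real.exp (L * a) * Real.exp (L * b)) * (nbr (S.markovSeq P (m + 1)) U).ncard := by
          ring
      _ = C ^ 2 * (Real.exp (-L) * Real.exp (-(2 * L * m)) * Real.exp (L * ((3 * n : ℕ) : ℝ))) *
            (nbr (S.markovSeq P (m + 1)) U).ncard := by
          rw [← Real.exp_add, ← Real.exp_add, ← Real.exp_add, ← hb]
          congr 3
          push_cast
          ring
      _ ≤ C ^ 2 * (Real.exp (-L) * Real.exp (-(2 * L * m)) * (S.NW P (3 * n) : ℝ)) *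
            (nbr (S.markovSeq P (m + 1)) U).ncard := by gcongr
      _ = _ := by ring

theorem MS.limit [CompactSpace X] [Nonempty X] [MeasurableSpace X] [BorelSpace X] (M : S.MS P e)
    {K : ℕ} (hK : S.Spec P K) {L C : ℝ} (hC : 1 ≤ C)
    (hg : ∀ n : ℕ, Real.exp (L * n) ≤ S.NW P n ∧ (S.NW P n : ℝ) ≤ C * Real.exp (L * n)) :
    ∃ μ : Measure X, IsProbabilityMeasure μ ∧ MeasurePreserving ⇑S.phi μ μ ∧
      (∀ (m : ℕ) x, x ∈ S.good P → ENNReal.ofReal (C⁻¹ * Real.exp (L * (1 - 2 * K)) *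
        Real.exp (-(2 * L * m))) ≤ μ (S.rset P m x)) ∧
      (∀ (m : ℕ) U, IsOpen U → μ U ≤
        ENNReal.ofReal ((nbr (S.markovSeq P (m + 1)) U).ncard * (C ^ 2 * Real.exp (-L) *
          Real.exp (-(2 * L * m))))) := by
  choose μs h1 h2 h3 using fun n : ℕ => M.approx hK hC hg (n + 1) n.succ_pos
  set F : Ultrafilter ℕ := Filter.hyperfilter ℕ with hF
  have hFle : (F : Filter ℕ) ≤ Filter.atTop := Nat.hyperfilter_le_atTop
  obtain ⟨μ, -, hμ⟩ := (isCompact_univ (X := ProbabilityMeasure X)).ultrafilter_le_nhds (F.map μs)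
    (by simp)
  have hμ' : Filter.Tendsto μs F (𝓝 μ) := hμ
  refine ⟨μ, inferInstance, ⟨S.phi_cont.measurable, ?_⟩, ?_, ?_⟩
  · have : IsProbabilityMeasure (Measure.map (⇑S.phi) (μ : Measure X)) :=
      Measure.isProbabilityMeasure_map S.phi_cont.measurable.aemeasurable
    refine ext_of_forall_integral_eq_of_IsFiniteMeasure fun f => ?_
    rw [integral_map S.phi_cont.measurable.aemeasurable f.continuous.measurable.aestronglyMeasurable]
    have t1 := (ProbabilityMeasure.tendsto_iff_forall_integral_tendsto.1 hμ') f
    have t2 := (ProbabilityMeasure.tendsto_iff_forall_integral_tendsto.1 hμ')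
      (f.compContinuous ⟨⇑S.phi, S.phi_cont⟩)
    simp only [BoundedContinuousFunction.compContinuous_apply, ContinuousMap.coe_mk] at t2
    have t3 := t2.sub t1
    have t4 : Filter.Tendsto (fun n : ℕ => 2 * ‖f‖ / ((n + 1 : ℕ) : ℝ)) F (𝓝 0) := by
      refine Filter.Tendsto.mono_left ?_ hFle
      exact (Filter.tendsto_add_atTop_iff_nat (f := fun n : ℕ => 2 * ‖f‖ / (n : ℝ)) 1).2
        (tendsto_const_div_atTop_nhds_zero_nat _)
    have t5 := squeeze_zero_norm (f := fun n => ∫ x, f (S.phi x) ∂(μs n : Measure X) - ∫ x, f x ∂(μs n : Measure X)) (fun n => h1 n f) t4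
    have := tendsto_nhds_unique t3 t5
    linarith
  · intro m x hx
    refine le_trans ?_ (ProbabilityMeasure.limsup_measure_closed_le_of_tendsto hμ' (M.rset_closed hx))
    refine le_trans ?_ Filter.liminf_le_limsup
    refine Filter.le_liminf_of_le (by isBoundedDefault) ?_
    filter_upwards [hFle (Filter.eventually_ge_atTop (m + K))] with n hn
    exact h2 n m x (by omega) hx
  · intro m U hU
    refine (ProbabilityMeasure.le_liminf_measure_open_of_tendsto hμ' hU).trans ?_
    refine le_trans Filter.liminf_le_limsup ?_
    refine Filter.limsup_le_of_le (by isBoundedDefault) ?_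
    filter_upwards [hFle (Filter.eventually_ge_atTop (m + K))] with n hn
    exact h3 n m U (by omega) hU

end SmaleSpace

open Set Metric MeasureTheory Topology
open scoped ENNReal NNReal

namespace SmaleSpace

variable {X : Type*} [MetricSpace X] {S : SmaleSpace X} {P : Set (Set X)} {e : ℝ}

theorem exp_eq_rpow (S : SmaleSpace X) (L : ℝ) (m : ℕ) :
    Real.exp (-(2 * L * m)) = ((S.lam⁻¹) ^ m) ^ (2 * L / Real.log S.lam) := by
  have hl : 0 < S.lam := zero_lt_one.trans S.one_lt_lam
  have hlog : 0 < Real.log S.lam := Real.log_pos S.one_lt_lam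
  rw [Real.rpow_def_of_pos (by positivity), Real.log_pow, Real.log_inv]
  congr 1
  field_simp

theorem MS.radius [CompactSpace X] [Infinite X] (M : S.MS P e)
    (hsc : ENNReal.ofReal S.lam = min (lipConst ⇑S.phi) (lipConst ⇑S.phi.symm)) :
    ∃ c D : ℝ, 0 < c ∧ 0 < D ∧ ∀ r : ℝ, 0 < r → r < diam (univ : Set X) → ∃ m : ℕ,
      sInf {n : ℕ | ∀ R ∈ S.markovSeq P n, diam R ≤ r} = m + 1 ∧
      (∀ R ∈ S.markovSeq P (m + 1), diam R ≤ r) ∧ c * (S.lam⁻¹) ^ m ≤ r ∧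
      r ≤ D * (S.lam⁻¹) ^ m := by
  obtain ⟨c, hc, hcR⟩ := M.diam_lower hsc
  have hl : 0 < S.lam := zero_lt_one.trans S.one_lt_lam
  have he := M.epos
  have hD : 0 < max (diam (univ : Set X)) (2 * e * S.lam) :=
    lt_max_of_lt_right (by positivity)
  refine ⟨c, max (diam (univ : Set X)) (2 * e * S.lam), hc, hD, ?_⟩
  intro r hr hrd
  set Q := {n : ℕ | ∀ R ∈ S.markovSeq P n, diam R ≤ r} with hQ
  have hne : Q.Nonempty := by
    obtain ⟨n, hn⟩ := lam_pow_small S (2 * e) hr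
    exact ⟨n + 1, fun R hR => (M.markov_diam hR).trans hn.le⟩
  have h0 : (0 : ℕ) ∉ Q := fun h => absurd (h univ rfl) (not_le.2 hrd)
  have hmem := Nat.sInf_mem hne
  have hpos : sInf Q ≠ 0 := fun h => h0 (h ▸ hmem)
  obtain ⟨m, hm⟩ := Nat.exists_eq_succ_of_ne_zero hpos
  refine ⟨m, hm, ?_, ?_, ?_⟩
  · rw [hm] at hmem; exact hmem
  · rw [hm] at hmem
    obtain ⟨R, hR, hRd⟩ := hcR m
    exact hRd.trans (hmem R hR)
  · have hnm : m ∉ Q := Nat.notMem_of_lt_sInf (by omega)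
    simp only [hQ, mem_ofPred_eq] at hnm
    push Not at hnm
    obtain ⟨R, hR, hRd⟩ := hnm
    cases m with
    | zero => simpa using Or.inl hrd.le
    | succ k =>
      refine hRd.le.trans ((M.markov_diam hR).trans ?_)
      have : 2 * e * (S.lam⁻¹) ^ k = 2 * e * S.lam * (S.lam⁻¹) ^ (k + 1) := by
        rw [pow_succ]; field_simp
      rw [this]
      gcongr
      exact le_max_right _ _

theorem ahlfors_aux [CompactSpace X] [MeasurableSpace X] [BorelSpace X] (μ : Measure X)
    {s a b : ℝ} (hs : 0 < s) (ha : 0 < a) (hb : 0 < b)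
    (h1 : ∀ (z : X) (r : ℝ), 0 < r → r < diam (univ : Set X) →
      ENNReal.ofReal (a * r ^ s) ≤ μ (closedBall z r))
    (h2 : ∀ (z : X) (r : ℝ), 0 < r → r < diam (univ : Set X) →
      μ (ball z r) ≤ ENNReal.ofReal (b * r ^ s)) : AhlforsRegular μ s := by
  refine ⟨hs, max a⁻¹ b, lt_max_of_lt_right hb, fun z r hr hrd => ⟨?_, ?_⟩⟩
  · rcases hr.eq_or_lt with rfl | hr
    · simp [Real.zero_rpow hs.ne']
    refine le_trans (ENNReal.ofReal_le_ofReal ?_) (h1 z r hr hrd)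
    gcongr
    rw [inv_le_comm₀ (lt_max_of_lt_right hb) ha]
    exact le_max_left _ _
  · have h3 : μ (closedBall z r) ≤ ENNReal.ofReal (b * r ^ s) := by
      have hc : Filter.Tendsto (fun r' : ℝ => ENNReal.ofReal (b * r' ^ s)) (𝓝[>] r)
          (𝓝 (ENNReal.ofReal (b * r ^ s))) := by
        refine (ENNReal.continuous_ofReal.tendsto _).comp ?_
        refine Filter.Tendsto.const_mul _ ?_
        exact ((Real.continuousAt_rpow_const r s (Or.inr hs.le)).tendsto).mono_left
          nhdsWithin_le_nhds
      refine ge_of_tendsto hc ?_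
      filter_upwards [Ioo_mem_nhdsGT hrd] with r' hr'
      exact (measure_mono (closedBall_subset_ball hr'.1)).trans
        (h2 z r' (hr.trans_lt hr'.1) hr'.2)
    refine h3.trans (ENNReal.ofReal_le_ofReal ?_)
    gcongr
    exact le_max_right _ _

theorem hausdorff_pos [CompactSpace X] [Nontrivial X] [MeasurableSpace X] [BorelSpace X]
    (μ : Measure X) [IsProbabilityMeasure μ] {s : ℝ} (h : AhlforsRegular μ s) :
    0 < μH[s] (univ : Set X) := by
  obtain ⟨hs, C, hC, hball⟩ := h
  have hd : 0 < diam (univ : Set X) := by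
    obtain ⟨x, y, hxy⟩ := exists_pair_ne X
    exact (dist_pos.2 hxy).trans_le (dist_le_diam_of_mem isBounded_of_compactSpace
      (mem_univ x) (mem_univ y))
  have hC0 : ENNReal.ofReal C ≠ 0 := by simpa using hC
  have hle : (ENNReal.ofReal C)⁻¹ • μ ≤ μH[s] := by
    refine Measure.le_hausdorffMeasure s _ (ENNReal.ofReal (diam (univ : Set X) / 2))
      (by simpa using hd) fun A hA => ?_
    rcases A.eq_empty_or_nonempty with rfl | ⟨x, hx⟩
    · simp
    have hA' : diam A ≤ diam (univ : Set X) / 2 :=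
      ENNReal.toReal_le_of_le_ofReal (by positivity) hA
    have hbdd : Bornology.IsBounded A := isBounded_of_compactSpace
    have hsub : A ⊆ closedBall x (diam A) := fun y hy => dist_le_diam_of_mem hbdd hy hx
    have h1 := (measure_mono hsub).trans (hball x (diam A) diam_nonneg (by linarith)).2
    rw [ENNReal.ofReal_mul hC.le, ← ENNReal.ofReal_rpow_of_nonneg diam_nonneg hs.le,
      diam, ENNReal.ofReal_toReal hbdd.ediam_ne_top] at h1
    rw [Measure.smul_apply, smul_eq_mul]
    rwa [mul_comm, ← div_eq_mul_inv, ENNReal.div_le_iff' hC0 ENNReal.ofReal_ne_top]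
  refine lt_of_lt_of_le ?_ (hle univ)
  rw [Measure.smul_apply, measure_univ, smul_eq_mul, mul_one, ENNReal.inv_pos]
  exact ENNReal.ofReal_ne_top

theorem MS.hausdorff_fin [CompactSpace X] [Nonempty X] [MeasurableSpace X] [BorelSpace X]
    (M : S.MS P e) {L C : ℝ} (hL : 0 < L) (hC : 1 ≤ C)
    (hg : ∀ n : ℕ, (S.NW P n : ℝ) ≤ C * Real.exp (L * n)) :
    μH[2 * L / Real.log S.lam] (univ : Set X) ≠ ∞ := by
  classical
  set s := 2 * L / Real.log S.lam with hs
  have hlog : 0 < Real.log S.lam := Real.log_pos S.one_lt_lam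
  have hl : 0 < S.lam := zero_lt_one.trans S.one_lt_lam
  have hs0 : 0 < s := by positivity
  have he := M.epos
  have hinst : ∀ n : ℕ, Fintype (S.W P (2 * n + 1)) := fun n => (M.W_finite _).fintype
  choose f hf using fun n : ℕ => exists_pt S P (2 * n + 1)
  have hgood : ∀ (n : ℕ) (w : S.W P (2 * n + 1)), (S.phi ^ (n : ℤ)) (f n w) ∈ S.good P :=
    fun n w => good_zpow (hf n w w.2).1 _
  have hdiam : ∀ (n : ℕ) (w : S.W P (2 * n + 1)),
      ediam (S.rset P n ((S.phi ^ (n : ℤ)) (f n w))) ≤ ENNReal.ofReal (2 * e * (S.lam⁻¹) ^ n) :=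
    fun n w => ediam_le_of_forall_dist_le fun y hy z hz => M.rset_dist (hgood n w) hy hz
  have hlim : Filter.Tendsto (fun n : ℕ => ENNReal.ofReal (2 * e * (S.lam⁻¹) ^ n)) Filter.atTop
      (𝓝 0) := by
    have h1 := tendsto_pow_atTop_nhds_zero_of_lt_one (inv_nonneg.2 hl.le)
      (inv_lt_one_of_one_lt₀ S.one_lt_lam)
    have h2 := ENNReal.tendsto_ofReal (h1.const_mul (2 * e))
    simpa using h2
  have key := Measure.hausdorffMeasure_le_liminf_sum (ι := fun n : ℕ => S.W P (2 * n + 1)) s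
    (univ : Set X) (l := Filter.atTop) _ hlim
    (fun n w => S.rset P n ((S.phi ^ (n : ℤ)) (f n w))) (Filter.Eventually.of_forall hdiam)
    (Filter.Eventually.of_forall fun n z _ => by
      obtain ⟨x, hx, hz⟩ := M.rset_cover n z
      have hw : S.wd P (2 * n + 1) ((S.phi ^ (-(n : ℤ))) x) ∈ S.W P (2 * n + 1) :=
        wd_mem (good_zpow hx _) _
      refine mem_iUnion.2 ⟨⟨_, hw⟩, ?_⟩
      have : S.rset P n x = S.rset P n ((S.phi ^ (n : ℤ))
          (f n (S.wd P (2 * n + 1) ((S.phi ^ (-(n : ℤ))) x)))) := by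
        refine M.rset_of_wd hx (good_zpow (hf n _ hw).1 _) ?_
        rw [zpow_neg_cancel, (hf n _ hw).2]
      rw [← this]; exact hz)
  refine ne_top_of_le_ne_top (ENNReal.ofReal_ne_top (r := C * Real.exp L * (2 * e) ^ s))
    (key.trans ?_)
  refine le_trans Filter.liminf_le_limsup ?_
  refine Filter.limsup_le_of_le (by isBoundedDefault) (Filter.Eventually.of_forall fun n => ?_)
  have h1 : ∀ w : S.W P (2 * n + 1), ediam (S.rset P n ((S.phi ^ (n : ℤ)) (f n w))) ^ s ≤
      ENNReal.ofReal ((2 * e * (S.lam⁻¹) ^ n) ^ s) := by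
    intro w
    rw [← ENNReal.ofReal_rpow_of_nonneg (by positivity) hs0.le]
    exact ENNReal.rpow_le_rpow (hdiam n w) hs0.le
  refine (Finset.sum_le_card_nsmul _ _ _ fun w _ => h1 w).trans ?_
  have hcard : (Finset.univ : Finset (S.W P (2 * n + 1))).card = S.NW P (2 * n + 1) := by
    rw [NW, Finset.card_univ, ← Nat.card_eq_fintype_card, Nat.card_coe_set_eq]
  rw [hcard, nsmul_eq_mul, ← ENNReal.ofReal_natCast, ← ENNReal.ofReal_mul (by positivity)]
  refine ENNReal.ofReal_le_ofReal ?_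
  rw [Real.mul_rpow (by positivity) (by positivity), hs, ← exp_eq_rpow S L n, ← hs]
  calc (S.NW P (2 * n + 1) : ℝ) * ((2 * e) ^ s * Real.exp (-(2 * L * n)))
      ≤ (C * Real.exp (L * ((2 * n + 1 : ℕ) : ℝ))) * ((2 * e) ^ s * Real.exp (-(2 * L * n))) := by
        gcongr
        exact hg _
    _ = C * (Real.exp (L * ((2 * n + 1 : ℕ) : ℝ)) * Real.exp (-(2 * L * n))) * (2 * e) ^ s := by
        ring
    _ = _ := by
        rw [← Real.exp_add]
        congr 3
        push_cast; ring

end SmaleSpace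

/-- For a mixing semi-conformal Smale space admitting a refining sequence of
Markov partitions with the uniform finite clustering property, there is a
`φ`-invariant Borel probability measure which is Ahlfors `s₀`-regular, where
`s₀ = 2 h(φ) / log λ_X`; consequently `dim_H X = s₀` and the `s₀`-dimensional
Hausdorff measure of `X` is strictly positive. -/
theorem semiconformal_bowen_measure_ahlfors_regular {X : Type*} [MetricSpace X]
    [CompactSpace X] [MeasurableSpace X] [BorelSpace X]
    (S : SmaleSpace X) (ε' ε'' : ℝ)
    (hε' : S.epsOne ε') (hε'' : S.epsTwo ε' ε'')
    (hmix : MixingSystem ⇑S.phi)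
    (hsc : ENNReal.ofReal S.lam = min (lipConst ⇑S.phi) (lipConst ⇑S.phi.symm))
    (R1 : Set (Set X)) (hMP : S.IsMarkovPartition ε' R1)
    (hdiam : ∀ R ∈ R1, diam R ≤ ε'' / 2)
    (hUFCP : ∃ B : ℕ, ∀ (x : X) (r : ℝ), 0 < r → r < diam (Set.univ : Set X) →
      (nbr (S.markovSeq R1
          (sInf {n : ℕ | ∀ R ∈ S.markovSeq R1 n, diam R ≤ r}))
        (closedBall x r)).ncard ≤ B)
    (h : ℝ) (hent : Dynamics.coverEntropy ⇑S.phi Set.univ = (h : EReal)) :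
    ∃ μ : Measure X, IsProbabilityMeasure μ ∧ MeasurePreserving ⇑S.phi μ μ ∧
      AhlforsRegular μ (2 * h / Real.log S.lam) ∧
      dimH (Set.univ : Set X) = ENNReal.ofReal (2 * h / Real.log S.lam) ∧
      0 < μH[2 * h / Real.log S.lam] (Set.univ : Set X) := by
  classical
  have M := SmaleSpace.MS.of S hε' hε'' hMP hdiam
  haveI : Nontrivial X := SmaleSpace.nontrivial_of_sc hsc
  haveI : Infinite X := SmaleSpace.infinite_of_mixing hmix
  obtain ⟨K, hK⟩ := M.spec hmix
  have hK : S.Spec R1 K := hK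
  obtain ⟨L, C, hC, hg⟩ := M.growth hK
  have hLpos : 0 < L := M.L_pos (fun n => (hg n).2) (by linarith)
  have hhL : h = L := by
    have := hent.symm.trans (M.entropy hC hg)
    exact_mod_cast this
  subst hhL
  have hC0 : 0 < C := by linarith
  have hl : 0 < S.lam := zero_lt_one.trans S.one_lt_lam
  have hlog : 0 < Real.log S.lam := Real.log_pos S.one_lt_lam
  set s := 2 * h / Real.log S.lam with hs
  have hs0 : 0 < s := by positivity
  obtain ⟨c, D, hc, hD, hrad⟩ := M.radius hsc
  obtain ⟨B, hB⟩ := hUFCP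
  obtain ⟨μ, hμ1, hμ2, hlow, hup⟩ := M.limit hK hC hg
  set k1 := C⁻¹ * Real.exp (h * (1 - 2 * K)) with hk1
  set k2 := C ^ 2 * Real.exp (-h) with hk2
  have hk1' : 0 < k1 := by positivity
  have hk2' : 0 < k2 := by positivity
  have hA : AhlforsRegular μ s := by
    refine SmaleSpace.ahlfors_aux μ hs0 (a := k1 * (D ^ s)⁻¹) (b := (B + 1) * k2 * (c ^ s)⁻¹)
      (by positivity) (by positivity) ?_ ?_
    · intro z r hr hrd
      obtain ⟨m, -, hm2, -, hm4⟩ := hrad r hr hrd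
      obtain ⟨x, hx, hz⟩ := M.rset_cover m z
      refine le_trans ?_ ((hlow m x hx).trans (measure_mono ?_))
      · refine ENNReal.ofReal_le_ofReal ?_
        rw [SmaleSpace.exp_eq_rpow S, ← hs, mul_assoc]
        refine mul_le_mul_of_nonneg_left ?_ hk1'.le
        rw [inv_mul_le_iff₀ (by positivity), ← Real.mul_rpow hD.le (by positivity)]
        exact Real.rpow_le_rpow hr.le hm4 hs0.le
      · intro y hy
        rw [mem_closedBall]
        exact (dist_le_diam_of_mem isBounded_of_compactSpace hy hz).trans
          (hm2 _ (SmaleSpace.rset_mem hx))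
    · intro z r hr hrd
      obtain ⟨m, hm1, -, hm3, -⟩ := hrad r hr hrd
      refine (hup m _ isOpen_ball).trans (ENNReal.ofReal_le_ofReal ?_)
      have h1 := hB z r hr hrd
      rw [hm1] at h1
      have h2 : (nbr (S.markovSeq R1 (m + 1)) (ball z r)).ncard ≤ B := by
        refine le_trans (ncard_le_ncard ?_ ((M.markov_finite (m + 1)).subset fun R hR => hR.1)) h1
        intro R hR
        exact ⟨hR.1, hR.2.mono (inter_subset_inter_right _ ball_subset_closedBall)⟩
      have h3 : ((nbr (S.markovSeq R1 (m + 1)) (ball z r)).ncard : ℝ) ≤ B + 1 := by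
        have : ((nbr (S.markovSeq R1 (m + 1)) (ball z r)).ncard : ℝ) ≤ B := by exact_mod_cast h2
        linarith
      rw [SmaleSpace.exp_eq_rpow S, ← hs]
      have h4 : ((S.lam⁻¹) ^ m) ^ s ≤ (c ^ s)⁻¹ * r ^ s := by
        rw [le_inv_mul_iff₀ (by positivity), ← Real.mul_rpow hc.le (by positivity)]
        exact Real.rpow_le_rpow (by positivity) hm3 hs0.le
      calc _ ≤ ((B : ℝ) + 1) * (k2 * ((c ^ s)⁻¹ * r ^ s)) := by gcongr
        _ = _ := by ring
  have hpos := SmaleSpace.hausdorff_pos μ hA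
  have hfin := M.hausdorff_fin hLpos hC (fun n => (hg n).2)
  refine ⟨μ, hμ1, hμ2, hA, ?_, hpos⟩
  have hcoe : ((Real.toNNReal s : ℝ≥0) : ℝ) = s := Real.coe_toNNReal s hs0.le
  have := dimH_of_hausdorffMeasure_ne_zero_ne_top (d := Real.toNNReal s) (s := (univ : Set X))
    (by rw [hcoe]; exact hpos.ne') (by rw [hcoe]; exact hfin)
  exact this
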